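/- arXiv:2510.27453 — 3 statements merged into one kernel-verified Lean document; each statement's English description precedes it below -/
import Mathlib

section
/- Let F(u,z) = (u·f₁(u,z), λ₂·z + h(u,z)) be a holomorphic vector field near 0 in ℂ² whose first component is divisible by u (so the plane {u = 0} is invariant), with f₁(0,0) = λ₁, h vanishing to second order at 0, and (λ₁, λ₂) a nonresonant spectral pair in the Poincaré domain. Then there exists a linearizing biholomorphism Ψ = (Ψ^u, Ψ^z) near 0, with Ψ(0) = 0, DΨ(0) = Id, and DΨ(w)·(λ₁w₁, λ₂w₂) = F(Ψ(w)), whose first component is itself divisible by the first coordinate: Ψ^u(0, z̃) = 0 for all small z̃, equivalently Ψ^u(ũ, z̃) = ũ·(1 + O(|(ũ,z̃)|)) with a holomorphic cofactor. -/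
/-- A spectral pair `(λ₁, λ₂)` lies in the Poincaré domain if `0` is not on the
closed segment between `λ₁` and `λ₂`. -/
def PoincareDomain (l₁ l₂ : ℂ) : Prop := (0 : ℂ) ∉ segment ℝ l₁ l₂

/-- A spectral pair `(λ₁, λ₂)` is resonant if `λ_ι = α₁λ₁ + α₂λ₂` for some
`ι ∈ {1,2}` and nonnegative integers `α₁, α₂` with `α₁ + α₂ ≥ 2`. -/
def Resonant (l₁ l₂ : ℂ) : Prop :=
  ∃ α₁ α₂ : ℕ, 2 ≤ α₁ + α₂ ∧
    (l₁ = (α₁ : ℂ) * l₁ + (α₂ : ℂ) * l₂ ∨ l₂ = (α₁ : ℂ) * l₁ + (α₂ : ℂ) * l₂)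

namespace PLin

/-- Exponents of monomials in two variables. -/
abbrev Idx : Type := Fin 2 →₀ ℕ

/-- Absolutely summable power series. -/
def WA : Type := lp (fun _ : Idx => ℂ) 1

noncomputable instance : NormedAddCommGroup WA := inferInstanceAs (NormedAddCommGroup (lp (fun _ : Idx => ℂ) 1))
noncomputable instance : NormedSpace ℂ WA := inferInstanceAs (NormedSpace ℂ (lp (fun _ : Idx => ℂ) 1))
instance : CompleteSpace WA := inferInstanceAs (CompleteSpace (lp (fun _ : Idx => ℂ) 1))

/-- coefficients -/
def cf (a : WA) : Idx → ℂ := (a : lp (fun _ : Idx => ℂ) 1).1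

theorem cf_inj {a b : WA} (h : cf a = cf b) : a = b := Subtype.ext h

theorem memlp_iff (c : Idx → ℂ) : Memℓp c 1 ↔ Summable (fun n => ‖c n‖) := by
  rw [memℓp_gen_iff (by norm_num)]
  simp

theorem cf_summable (a : WA) : Summable (fun n => ‖cf a n‖) :=
  (memlp_iff _).1 (a : lp (fun _ : Idx => ℂ) 1).2

/-- constructor -/
def mkA (c : Idx → ℂ) (h : Summable (fun n => ‖c n‖)) : WA := ⟨c, (memlp_iff c).2 h⟩

@[simp] theorem cf_mkA (c h) : cf (mkA c h) = c := rfl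
@[simp] theorem cf_add (a b : WA) : cf (a + b) = cf a + cf b := rfl
@[simp] theorem cf_neg (a : WA) : cf (-a) = - cf a := rfl
@[simp] theorem cf_sub (a b : WA) : cf (a - b) = cf a - cf b := rfl
@[simp] theorem cf_zero : cf 0 = 0 := rfl
@[simp] theorem cf_smul (c : ℂ) (a : WA) : cf (c • a) = c • cf a := rfl

theorem norm_eq (a : WA) : ‖a‖ = ∑' n, ‖cf a n‖ := by
  have := lp.norm_eq_tsum_rpow (p := 1) (by norm_num) (a : lp (fun _ : Idx => ℂ) 1)
  simp only [ENNReal.toReal_one, Real.rpow_one, div_one] at this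
  exact this

theorem norm_cf_le (a : WA) (n : Idx) : ‖cf a n‖ ≤ ‖a‖ := by
  rw [norm_eq]
  exact (cf_summable a).le_tsum n (fun _ _ => norm_nonneg _)

/-- as formal power series -/
def toMv (a : WA) : MvPowerSeries (Fin 2) ℂ := cf a

theorem coeff_toMv (a : WA) (n : Idx) : MvPowerSeries.coeff n (toMv a) = cf a n := rfl

theorem toMv_inj {a b : WA} (h : toMv a = toMv b) : a = b := cf_inj h

theorem mul_aux (x y : Idx → ℂ) (hx : Summable (fun n => ‖x n‖)) (hy : Summable (fun n => ‖y n‖)) :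
    Summable (fun n => ∑ p ∈ Finset.HasAntidiagonal.antidiagonal n, ‖x p.1‖ * ‖y p.2‖) :=
  summable_sum_mul_antidiagonal_of_summable_mul (A := Idx) (f := fun n => ‖x n‖) (g := fun n => ‖y n‖)
    (Summable.mul_of_nonneg hx hy (fun _ => norm_nonneg _) (fun _ => norm_nonneg _))

theorem mul_aux_le (x y : Idx → ℂ) (n : Idx) : ‖∑ p ∈ Finset.HasAntidiagonal.antidiagonal n, x p.1 * y p.2‖ ≤
    ∑ p ∈ Finset.HasAntidiagonal.antidiagonal n, ‖x p.1‖ * ‖y p.2‖ :=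
  (norm_sum_le _ _).trans (le_of_eq (Finset.sum_congr rfl (fun _ _ => norm_mul _ _)))

noncomputable instance : Mul WA := ⟨fun a b => mkA (fun n => ∑ p ∈ Finset.HasAntidiagonal.antidiagonal n, cf a p.1 * cf b p.2)
  (Summable.of_nonneg_of_le (fun _ => norm_nonneg _) (mul_aux_le _ _)
    (mul_aux _ _ (cf_summable a) (cf_summable b)))⟩

theorem cf_mul (a b : WA) (n : Idx) :
    cf (a * b) n = ∑ p ∈ Finset.HasAntidiagonal.antidiagonal n, cf a p.1 * cf b p.2 := rfl

open Classical in
theorem summable_single (m : Idx) : Summable (fun n : Idx => ‖(if n = m then (1:ℂ) else 0)‖) := by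
  apply summable_of_ne_finset_zero (s := {m})
  intro b hb
  simp at hb
  simp [hb]

open Classical in
/-- the monomial -/
noncomputable def mono (m : Idx) : WA := mkA (fun n => if n = m then 1 else 0) (summable_single m)

open Classical in
theorem cf_mono (m n : Idx) : cf (mono m) n = if n = m then 1 else 0 := rfl

theorem norm_mono (m : Idx) : ‖mono m‖ = 1 := by
  classical
  rw [norm_eq, tsum_eq_single m]
  · simp [cf_mono]
  · intro n hn; simp [cf_mono, hn]

noncomputable instance : One WA := ⟨mono 0⟩

theorem one_def : (1 : WA) = mono 0 := rfl

theorem toMv_mul (a b : WA) : toMv (a * b) = toMv a * toMv b := by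
  ext n
  rw [coeff_toMv, cf_mul, MvPowerSeries.coeff_mul]; rfl

theorem toMv_add (a b : WA) : toMv (a + b) = toMv a + toMv b := rfl
theorem toMv_zero : toMv 0 = 0 := rfl
theorem toMv_smul (c : ℂ) (a : WA) : toMv (c • a) = c • toMv a := rfl
theorem toMv_one : toMv 1 = 1 := by
  classical
  ext n
  rw [coeff_toMv, one_def, cf_mono, MvPowerSeries.coeff_one]

theorem norm_mul_le_aux (a b : WA) : ‖a * b‖ ≤ ‖a‖ * ‖b‖ := by
  rw [norm_eq, norm_eq a, norm_eq b, (cf_summable a).tsum_mul_tsum_eq_tsum_sum_antidiagonal (cf_summable b)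
    (Summable.mul_of_nonneg (cf_summable a) (cf_summable b) (fun _ => norm_nonneg _) (fun _ => norm_nonneg _))]
  exact Summable.tsum_le_tsum (mul_aux_le _ _) (cf_summable (a*b)) (mul_aux _ _ (cf_summable a) (cf_summable b))

noncomputable instance : NormedCommRing WA :=
  { (inferInstance : NormedAddCommGroup WA) with
    mul := (· * ·)
    one := 1
    left_distrib := fun a b c => toMv_inj (by simp only [toMv_mul, toMv_add, mul_add])
    right_distrib := fun a b c => toMv_inj (by simp only [toMv_mul, toMv_add, add_mul])
    zero_mul := fun a => toMv_inj (by simp only [toMv_mul, toMv_zero, zero_mul])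
    mul_zero := fun a => toMv_inj (by simp only [toMv_mul, toMv_zero, mul_zero])
    mul_assoc := fun a b c => toMv_inj (by simp only [toMv_mul, mul_assoc])
    one_mul := fun a => toMv_inj (by simp only [toMv_mul, toMv_one, one_mul])
    mul_one := fun a => toMv_inj (by simp only [toMv_mul, toMv_one, mul_one])
    mul_comm := fun a b => toMv_inj (by simp only [toMv_mul, mul_comm])
    norm_mul_le := norm_mul_le_aux }

noncomputable instance : NormOneClass WA := ⟨norm_mono 0⟩

noncomputable instance : NormedAlgebra ℂ WA :=
  { Algebra.ofModule
      (fun c a b => toMv_inj (by simp only [toMv_mul, toMv_smul, smul_mul_assoc]))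
      (fun c a b => toMv_inj (by simp only [toMv_mul, toMv_smul, mul_smul_comm])) with
    norm_smul_le := fun c a => norm_smul_le c a }

theorem toMv_pow (a : WA) (k : ℕ) : toMv (a ^ k) = toMv a ^ k := by
  induction k with
  | zero => simp [toMv_one]
  | succ k ih => rw [pow_succ, pow_succ, toMv_mul, ih]

/-- coefficient functional -/
noncomputable def cfL (n : Idx) : WA →L[ℂ] ℂ :=
  LinearMap.mkContinuous ⟨⟨fun a => cf a n, fun _ _ => rfl⟩, fun _ _ => rfl⟩ 1
    (fun a => by rw [one_mul]; exact norm_cf_le a n)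

theorem cfL_apply (n : Idx) (a : WA) : cfL n a = cf a n := rfl

/-- diagonal operator -/
noncomputable def diag (μ : Idx → ℂ) (E : ℝ) (hμ : ∀ n, ‖μ n‖ ≤ E) (a : WA) : WA :=
  mkA (fun n => μ n * cf a n) (Summable.of_nonneg_of_le (fun _ => norm_nonneg _)
    (fun n => by rw [norm_mul]; exact mul_le_mul_of_nonneg_right (hμ n) (norm_nonneg _))
    ((cf_summable a).mul_left E))

theorem cf_diag (μ : Idx → ℂ) (E : ℝ) (hμ : ∀ n, ‖μ n‖ ≤ E) (a : WA) (n : Idx) :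
    cf (diag μ E hμ a) n = μ n * cf a n := rfl

theorem norm_diag_le (μ : Idx → ℂ) (E : ℝ) (hμ : ∀ n, ‖μ n‖ ≤ E) (a : WA) :
    ‖diag μ E hμ a‖ ≤ E * ‖a‖ := by
  rw [norm_eq, norm_eq a, ← tsum_mul_left]
  refine Summable.tsum_le_tsum (fun n => ?_) (cf_summable _) ((cf_summable a).mul_left E)
  rw [cf_diag, norm_mul]; exact mul_le_mul_of_nonneg_right (hμ n) (norm_nonneg _)

theorem diag_sub (μ : Idx → ℂ) (E : ℝ) (hμ : ∀ n, ‖μ n‖ ≤ E) (a b : WA) :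
    diag μ E hμ a - diag μ E hμ b = diag μ E hμ (a - b) := by
  apply cf_inj; funext n
  simp only [cf_diag, cf_sub, Pi.sub_apply]; ring

end PLin

namespace PLin

/-- total degree -/
def dg (n : Idx) : ℕ := n 0 + n 1

/-- index equivalence -/
noncomputable def idxE : Idx ≃ ℕ × ℕ := Finsupp.equivFunOnFinite.trans (finTwoArrowEquiv ℕ)

theorem idxE_fst (n : Idx) : (idxE n).1 = n 0 := rfl
theorem idxE_snd (n : Idx) : (idxE n).2 = n 1 := rfl

theorem idx_ext {n m : Idx} (h0 : n 0 = m 0) (h1 : n 1 = m 1) : n = m := by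
  ext i; fin_cases i <;> assumption

theorem dg_eq_degree (n : Idx) : n.degree = dg n := by
  rw [Finsupp.degree_eq_sum]; simp [dg]

theorem dg_eq_zero {n : Idx} (h : dg n = 0) : n = 0 := by
  unfold dg at h
  apply idx_ext <;> simp <;> omega

theorem summable_geom {s t : ℝ} (hs : 0 ≤ s) (hs1 : s < 1) (ht : 0 ≤ t) (ht1 : t < 1) :
    Summable (fun n : Idx => s ^ (n 0) * t ^ (n 1)) := by
  have h := Summable.mul_of_nonneg (summable_geometric_of_lt_one hs hs1)
    (summable_geometric_of_lt_one ht ht1) (fun _ => by positivity) (fun _ => by positivity)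
  exact (Equiv.summable_iff idxE).2 h

theorem summable_dg : Summable (fun n : Idx => (dg n : ℝ) * (1/2 : ℝ) ^ (dg n)) := by
  have h1 : Summable (fun n : ℕ => (n : ℝ) * (1/2:ℝ)^n) := by
    simpa using summable_pow_mul_geometric_of_norm_lt_one 1 (r := (1/2:ℝ)) (by norm_num)
  have h0 : Summable (fun n : ℕ => (1/2:ℝ)^n) := summable_geometric_of_lt_one (by norm_num) (by norm_num)
  have hA := Summable.mul_of_nonneg h1 h0 (fun _ => by positivity) (fun _ => by positivity)
  have hB := Summable.mul_of_nonneg h0 h1 (fun _ => by positivity) (fun _ => by positivity)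
  refine ((Equiv.summable_iff idxE).2 (hA.add hB)).congr (fun n => ?_)
  simp only [Function.comp, idxE_fst, idxE_snd, dg, pow_add]
  push_cast; ring

section gen
variable {B : Type*} [NormedCommRing B] [NormOneClass B] [NormedAlgebra ℂ B] [CompleteSpace B]

/-- functional calculus -/
noncomputable def Ser (g : Idx → ℂ) (x y : B) : B := ∑' n : Idx, g n • (x ^ (n 0) * y ^ (n 1))

theorem norm_monom_le (x y : B) (i j : ℕ) : ‖x ^ i * y ^ j‖ ≤ ‖x‖ ^ i * ‖y‖ ^ j :=
  (norm_mul_le _ _).trans (mul_le_mul (norm_pow_le _ _) (norm_pow_le _ _) (norm_nonneg _) (by positivity))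

theorem ser_summable {g : Idx → ℂ} {M : ℝ} (hg : ∀ n, ‖g n‖ ≤ M) {x y : B} (hx : ‖x‖ < 1) (hy : ‖y‖ < 1) :
    Summable (fun n : Idx => g n • (x ^ (n 0) * y ^ (n 1))) := by
  refine Summable.of_norm_bounded
    ((summable_geom (norm_nonneg x) hx (norm_nonneg y) hy).mul_left M) (fun n => ?_)
  refine (norm_smul_le _ _).trans ?_
  exact mul_le_mul (hg n) (norm_monom_le _ _ _ _) (norm_nonneg _) ((norm_nonneg _).trans (hg n))

theorem pow_sub_le {s : ℝ} {x x' : B} (hx : ‖x‖ ≤ s) (hx' : ‖x'‖ ≤ s) (i : ℕ) :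
    s * ‖x ^ i - x' ^ i‖ ≤ i * s ^ i * ‖x - x'‖ := by
  have hs : 0 ≤ s := (norm_nonneg _).trans hx
  induction i with
  | zero => simp
  | succ i ih =>
    have e : x ^ (i+1) - x' ^ (i+1) = x * (x ^ i - x' ^ i) + (x - x') * x' ^ i := by ring
    have h1 : ‖x * (x ^ i - x' ^ i)‖ ≤ s * ‖x ^ i - x' ^ i‖ :=
      (norm_mul_le _ _).trans (mul_le_mul_of_nonneg_right hx (norm_nonneg _))
    have h2 : ‖(x - x') * x' ^ i‖ ≤ ‖x - x'‖ * s ^ i :=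
      (norm_mul_le _ _).trans (mul_le_mul_of_nonneg_left
        ((norm_pow_le _ _).trans (pow_le_pow_left₀ (norm_nonneg _) hx' i)) (norm_nonneg _))
    rw [e]
    calc s * ‖x * (x ^ i - x' ^ i) + (x - x') * x' ^ i‖
        ≤ s * (s * ‖x ^ i - x' ^ i‖ + ‖x - x'‖ * s ^ i) :=
          mul_le_mul_of_nonneg_left ((norm_add_le _ _).trans (add_le_add h1 h2)) hs
      _ ≤ s * (i * s ^ i * ‖x - x'‖ + ‖x - x'‖ * s ^ i) := by gcongr
      _ = _ := by push_cast; ring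

theorem monom_sub_le {s : ℝ} {x x' y y' : B} (hx : ‖x‖ ≤ s) (hx' : ‖x'‖ ≤ s)
    (hy : ‖y‖ ≤ s) (hy' : ‖y'‖ ≤ s) (i j : ℕ) :
    s * ‖x ^ i * y ^ j - x' ^ i * y' ^ j‖ ≤ (i + j : ℕ) * s ^ (i + j) * (‖x - x'‖ + ‖y - y'‖) := by
  have hs : 0 ≤ s := (norm_nonneg _).trans hx
  have e : x ^ i * y ^ j - x' ^ i * y' ^ j = (x ^ i - x' ^ i) * y ^ j + x' ^ i * (y ^ j - y' ^ j) := by ring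
  have h1 : ‖(x ^ i - x' ^ i) * y ^ j‖ ≤ ‖x ^ i - x' ^ i‖ * s ^ j :=
    (norm_mul_le _ _).trans (mul_le_mul_of_nonneg_left
        ((norm_pow_le _ _).trans (pow_le_pow_left₀ (norm_nonneg _) hy j)) (norm_nonneg _))
  have h2 : ‖x' ^ i * (y ^ j - y' ^ j)‖ ≤ s ^ i * ‖y ^ j - y' ^ j‖ :=
    (norm_mul_le _ _).trans (mul_le_mul_of_nonneg_right
        ((norm_pow_le _ _).trans (pow_le_pow_left₀ (norm_nonneg _) hx' i)) (norm_nonneg _))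
  have h3 := pow_sub_le hx hx' i
  have h4 := pow_sub_le hy hy' j
  rw [e]
  calc s * ‖(x ^ i - x' ^ i) * y ^ j + x' ^ i * (y ^ j - y' ^ j)‖
      ≤ s * (‖x ^ i - x' ^ i‖ * s ^ j + s ^ i * ‖y ^ j - y' ^ j‖) :=
        mul_le_mul_of_nonneg_left ((norm_add_le _ _).trans (add_le_add h1 h2)) hs
    _ = (s * ‖x ^ i - x' ^ i‖) * s ^ j + s ^ i * (s * ‖y ^ j - y' ^ j‖) := by ring
    _ ≤ (i * s ^ i * ‖x - x'‖) * s ^ j + s ^ i * (j * s ^ j * ‖y - y'‖) := by gcongr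
    _ = s ^ (i + j) * (i * ‖x - x'‖ + j * ‖y - y'‖) := by ring
    _ ≤ s ^ (i + j) * ((i + j) * ‖x - x'‖ + (i + j) * ‖y - y'‖) := by
        gcongr <;> simp
    _ = _ := by push_cast; ring

/-- Lipschitz constant -/
noncomputable def lipC (M : ℝ) (k : ℕ) : ℝ := ∑' n : Idx, M * 2 ^ (k + 1) * ((dg n : ℝ) * (1/2 : ℝ) ^ (dg n))

theorem term_lip {g : Idx → ℂ} {M : ℝ} (hg : ∀ n, ‖g n‖ ≤ M) (k : ℕ) (hk : ∀ n, dg n ≤ k → g n = 0)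
    {s : ℝ} (hs0 : 0 < s) (hs : s ≤ 1/2)
    {x x' y y' : B} (hx : ‖x‖ ≤ s) (hx' : ‖x'‖ ≤ s) (hy : ‖y‖ ≤ s) (hy' : ‖y'‖ ≤ s) (n : Idx) :
    ‖g n • (x ^ (n 0) * y ^ (n 1)) - g n • (x' ^ (n 0) * y' ^ (n 1))‖ ≤
     M * 2 ^ (k + 1) * ((dg n : ℝ) * (1/2 : ℝ) ^ (dg n)) * (s ^ k * (‖x - x'‖ + ‖y - y'‖)) := by
  have hM : 0 ≤ M := (norm_nonneg _).trans (hg 0)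
  rw [← smul_sub]
  by_cases hn : dg n ≤ k
  · rw [hk n hn, zero_smul, norm_zero]; positivity
  push Not at hn
  obtain ⟨l, hl⟩ := Nat.exists_eq_add_of_le (Nat.succ_le_of_lt hn)
  have h1 := monom_sub_le hx hx' hy hy' (n 0) (n 1)
  rw [show n 0 + n 1 = dg n from rfl] at h1
  generalize ‖x - x'‖ + ‖y - y'‖ = d at *
  have hd : 0 ≤ d := by
    by_contra hc
    push Not at hc
    have : 0 < (dg n : ℝ) := by
      have : 0 < dg n := by omega
      exact_mod_cast this
    have : (dg n : ℝ) * s ^ dg n * d < 0 := mul_neg_of_pos_of_neg (by positivity) hc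
    have h0 : 0 ≤ s * ‖x ^ (n 0) * y ^ (n 1) - x' ^ (n 0) * y' ^ (n 1)‖ := by positivity
    linarith
  have h2 : ‖x ^ (n 0) * y ^ (n 1) - x' ^ (n 0) * y' ^ (n 1)‖ ≤ dg n * (s ^ k * s ^ l) * d := by
    have : s ^ dg n = s * (s ^ k * s ^ l) := by rw [hl, Nat.succ_eq_add_one]; ring
    rw [this] at h1
    refine le_of_mul_le_mul_left (h1.trans (le_of_eq ?_)) hs0
    ring
  have h3 : s ^ l ≤ 2 ^ (k+1) * (1/2 : ℝ) ^ (dg n) := by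
    have : (2:ℝ) ^ (k+1) * (1/2 : ℝ) ^ (dg n) = (1/2)^l := by
      rw [hl, pow_add (1/2 : ℝ), ← mul_assoc, Nat.succ_eq_add_one, ← mul_pow]; norm_num
    rw [this]; exact pow_le_pow_left₀ hs0.le hs l
  calc ‖g n • (x ^ (n 0) * y ^ (n 1) - x' ^ (n 0) * y' ^ (n 1))‖
      ≤ M * (dg n * (s ^ k * s ^ l) * d) :=
        (norm_smul_le _ _).trans (mul_le_mul (hg n) h2 (norm_nonneg _) hM)
    _ ≤ M * (dg n * (s ^ k * (2 ^ (k+1) * (1/2 : ℝ) ^ (dg n))) * d) := by gcongr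
    _ = _ := by ring

theorem ser_lip {g : Idx → ℂ} {M : ℝ} (hg : ∀ n, ‖g n‖ ≤ M) (k : ℕ) (hk : ∀ n, dg n ≤ k → g n = 0)
    {s : ℝ} (hs0 : 0 < s) (hs : s ≤ 1/2)
    {x x' y y' : B} (hx : ‖x‖ ≤ s) (hx' : ‖x'‖ ≤ s) (hy : ‖y‖ ≤ s) (hy' : ‖y'‖ ≤ s) :
    ‖Ser g x y - Ser g x' y'‖ ≤ lipC M k * s ^ k * (‖x - x'‖ + ‖y - y'‖) := by
  have e : Ser g x y - Ser g x' y' =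
      ∑' n : Idx, (g n • (x ^ (n 0) * y ^ (n 1)) - g n • (x' ^ (n 0) * y' ^ (n 1))) :=
    ((ser_summable hg (lt_of_le_of_lt hx (by linarith)) (lt_of_le_of_lt hy (by linarith))).tsum_sub
    (ser_summable hg (lt_of_le_of_lt hx' (by linarith)) (lt_of_le_of_lt hy' (by linarith)))).symm
  have hsum := ((summable_dg.mul_left (M * 2 ^ (k+1))).mul_right (s ^ k * (‖x - x'‖ + ‖y - y'‖))).hasSum
  have := tsum_of_norm_bounded hsum (term_lip hg k hk hs0 hs hx hx' hy hy')
  rw [tsum_mul_right, ← mul_assoc] at this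
  rw [e]
  exact this

theorem ser_zero (g : Idx → ℂ) : Ser g (0 : B) 0 = g 0 • 1 := by
  unfold Ser
  rw [tsum_eq_single 0]
  · simp
  · intro n hn
    have : n 0 ≠ 0 ∨ n 1 ≠ 0 := by
      by_contra hc; push Not at hc
      exact hn (idx_ext (by simp [hc]) (by simp [hc]))
    rcases this with h | h <;> simp [h]

end gen

theorem lipC_nonneg {M : ℝ} (hM : 0 ≤ M) (k : ℕ) : 0 ≤ lipC M k := tsum_nonneg (fun n => by positivity)

/-- evaluation -/
noncomputable def ev (w : ℂ × ℂ) (a : WA) : ℂ := Ser (cf a) w.1 w.2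

theorem ev_term_le (w : ℂ × ℂ) (hw : ‖w‖ ≤ 1) (a : WA) (n : Idx) :
    ‖cf a n • (w.1 ^ (n 0) * w.2 ^ (n 1))‖ ≤ ‖cf a n‖ := by
  rw [norm_smul]
  refine mul_le_of_le_one_right (norm_nonneg _) ((norm_monom_le _ _ _ _).trans ?_)
  exact mul_le_one₀ (pow_le_one₀ (norm_nonneg _) ((norm_fst_le w).trans hw)) (by positivity)
    (pow_le_one₀ (norm_nonneg _) ((norm_snd_le w).trans hw))

theorem ev_summable (w : ℂ × ℂ) (hw : ‖w‖ ≤ 1) (a : WA) :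
    Summable (fun n : Idx => ‖cf a n • (w.1 ^ (n 0) * w.2 ^ (n 1))‖) :=
  Summable.of_nonneg_of_le (fun _ => norm_nonneg _) (ev_term_le w hw a) (cf_summable a)

theorem ev_add (w : ℂ × ℂ) (hw : ‖w‖ ≤ 1) (a b : WA) : ev w (a + b) = ev w a + ev w b := by
  unfold ev Ser
  rw [← (ev_summable w hw a).of_norm.tsum_add (ev_summable w hw b).of_norm]
  simp [add_mul]

theorem ev_smul (w : ℂ × ℂ) (c : ℂ) (a : WA) : ev w (c • a) = c * ev w a := by
  unfold ev Ser
  rw [← tsum_mul_left]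
  simp [mul_assoc]

theorem ev_norm_le (w : ℂ × ℂ) (hw : ‖w‖ ≤ 1) (a : WA) : ‖ev w a‖ ≤ ‖a‖ := by
  rw [norm_eq]
  exact tsum_of_norm_bounded (cf_summable a).hasSum (ev_term_le w hw a)

theorem ev_mul (w : ℂ × ℂ) (hw : ‖w‖ ≤ 1) (a b : WA) : ev w (a * b) = ev w a * ev w b := by
  have ha := ev_summable w hw a
  have hb := ev_summable w hw b
  unfold ev Ser
  have hmul : Summable (fun p : Idx × Idx => (cf a p.1 • (w.1 ^ (p.1 0) * w.2 ^ (p.1 1))) *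
      (cf b p.2 • (w.1 ^ (p.2 0) * w.2 ^ (p.2 1)))) :=
    summable_mul_of_summable_norm (f := fun n : Idx => cf a n • (w.1 ^ (n 0) * w.2 ^ (n 1)))
      (g := fun n : Idx => cf b n • (w.1 ^ (n 0) * w.2 ^ (n 1))) ha hb
  rw [Summable.tsum_mul_tsum_eq_tsum_sum_antidiagonal (A := Idx)
    (f := fun n : Idx => cf a n • (w.1 ^ (n 0) * w.2 ^ (n 1)))
    (g := fun n : Idx => cf b n • (w.1 ^ (n 0) * w.2 ^ (n 1))) ha.of_norm hb.of_norm hmul]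
  refine tsum_congr (fun n => ?_)
  rw [cf_mul, Finset.sum_smul]
  refine Finset.sum_congr rfl (fun p hp => ?_)
  rw [Finset.HasAntidiagonal.mem_antidiagonal] at hp
  subst hp
  simp only [Finsupp.add_apply, smul_eq_mul, pow_add]; ring

theorem ev_mono (w : ℂ × ℂ) (m : Idx) : ev w (mono m) = w.1 ^ (m 0) * w.2 ^ (m 1) := by
  classical
  unfold ev Ser
  rw [tsum_eq_single m]
  · simp [cf_mono]
  · intro n hn; simp [cf_mono, hn]

theorem ev_one (w : ℂ × ℂ) : ev w 1 = 1 := by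
  rw [one_def, ev_mono]; simp

theorem ev_pow (w : ℂ × ℂ) (hw : ‖w‖ ≤ 1) (a : WA) (k : ℕ) : ev w (a ^ k) = ev w a ^ k := by
  induction k with
  | zero => simp [ev_one]
  | succ k ih => rw [pow_succ, pow_succ, ev_mul w hw, ih]

/-- evaluation as continuous functional -/
noncomputable def evL (w : ℂ × ℂ) (hw : ‖w‖ ≤ 1) : WA →L[ℂ] ℂ :=
  LinearMap.mkContinuous ⟨⟨fun a => ev w a, ev_add w hw⟩, ev_smul w⟩ 1
    (fun a => by rw [one_mul]; exact ev_norm_le w hw a)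

theorem ev_ser (w : ℂ × ℂ) (hw : ‖w‖ ≤ 1) {g : Idx → ℂ} {M : ℝ} (hg : ∀ n, ‖g n‖ ≤ M)
    {x y : WA} (hx : ‖x‖ < 1) (hy : ‖y‖ < 1) :
    ev w (Ser g x y) = Ser g (ev w x) (ev w y) := by
  change evL w hw (Ser g x y) = _
  unfold Ser
  rw [(evL w hw).map_tsum (ser_summable hg hx hy)]
  refine tsum_congr (fun n => ?_)
  rw [map_smul]
  change _ • ev w _ = _
  rw [ev_mul w hw, ev_pow w hw, ev_pow w hw]

theorem cf_zero_of_order {k : ℕ} {a : WA} (h : (k : ℕ∞) ≤ (toMv a).order) {m : Idx} (hm : dg m < k) : cf a m = 0 := by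
  rw [← coeff_toMv]
  apply MvPowerSeries.coeff_of_lt_order
  rw [dg_eq_degree]
  exact lt_of_lt_of_le (by exact_mod_cast hm) h

theorem one_le_order {a : WA} (h : cf a 0 = 0) : (1 : ℕ∞) ≤ (toMv a).order := by
  rw [MvPowerSeries.one_le_order_iff_constCoeff_eq_zero]
  exact h

theorem cf_ser_zero {g : Idx → ℂ} {M : ℝ} (hg : ∀ n, ‖g n‖ ≤ M) (k : ℕ) (hk : ∀ n, dg n ≤ k → g n = 0)
    {x y : WA} (hx : ‖x‖ < 1) (hy : ‖y‖ < 1) (hx0 : cf x 0 = 0) (hy0 : cf y 0 = 0)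
    {m : Idx} (hm : dg m ≤ k) : cf (Ser g x y) m = 0 := by
  rw [← cfL_apply]
  unfold Ser
  rw [(cfL m).map_tsum (ser_summable hg hx hy)]
  refine (tsum_congr (fun n => ?_)).trans tsum_zero
  rw [map_smul, cfL_apply]
  by_cases hn : dg n ≤ k
  · rw [hk n hn, zero_smul]
  · rw [cf_zero_of_order (k := dg n) _ (by omega), smul_zero]
    rw [toMv_mul, toMv_pow, toMv_pow]
    refine le_trans ?_ (MvPowerSeries.le_order_mul)
    unfold dg
    push_cast
    refine add_le_add ?_ ?_
    · refine le_trans ?_ (MvPowerSeries.le_order_pow (n 0))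
      simpa using nsmul_le_nsmul_right (one_le_order hx0) (n 0)
    · refine le_trans ?_ (MvPowerSeries.le_order_pow (n 1))
      simpa using nsmul_le_nsmul_right (one_le_order hy0) (n 1)

end PLin

namespace PLin

/-- derivative of a monomial -/
noncomputable def Dm (n : Idx) (w : ℂ × ℂ) : ℂ × ℂ →L[ℂ] ℂ :=
  ((n 0 : ℂ) * w.1 ^ (n 0 - 1) * w.2 ^ (n 1)) • ContinuousLinearMap.fst ℂ ℂ ℂ +
  ((n 1 : ℂ) * w.1 ^ (n 0) * w.2 ^ (n 1 - 1)) • ContinuousLinearMap.snd ℂ ℂ ℂ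

theorem hasFDerivAt_monom (n : Idx) (w : ℂ × ℂ) :
    HasFDerivAt (fun w : ℂ × ℂ => w.1 ^ (n 0) * w.2 ^ (n 1)) (Dm n w) w := by
  have h1 : HasFDerivAt (fun w : ℂ × ℂ => w.1 ^ (n 0)) _ w := (hasFDerivAt_fst (𝕜 := ℂ) (p := w)).pow (n 0)
  have h2 : HasFDerivAt (fun w : ℂ × ℂ => w.2 ^ (n 1)) _ w := (hasFDerivAt_snd (𝕜 := ℂ) (p := w)).pow (n 1)
  refine (h1.mul h2).congr_fderiv ?_
  ext <;> simp [Dm] <;> ring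

theorem Dm_cont (n : Idx) : Continuous (Dm n) := by
  unfold Dm; fun_prop

theorem pow_pred_le {t : ℝ} (ht0 : 0 ≤ t) (ht : t ≤ 1/2) (i : ℕ) : i * t ^ (i - 1) ≤ 2 * i * (1/2 : ℝ) ^ i := by
  cases i with
  | zero => simp
  | succ i =>
    have := pow_le_pow_left₀ ht0 ht i
    simp only [Nat.add_sub_cancel, pow_succ]
    have h2 : (0:ℝ) ≤ (i + 1 : ℕ) := by positivity
    nlinarith [mul_le_mul_of_nonneg_left this h2]

theorem norm_Dm_le (n : Idx) {w : ℂ × ℂ} (hw : ‖w‖ ≤ 1/2) : ‖Dm n w‖ ≤ 2 * (dg n * (1/2 : ℝ) ^ dg n) := by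
  have a1 : ‖w.1‖ ≤ 1/2 := (norm_fst_le w).trans hw
  have a2 : ‖w.2‖ ≤ 1/2 := (norm_snd_le w).trans hw
  have b1 := pow_pred_le (norm_nonneg w.1) a1 (n 0)
  have b2 := pow_pred_le (norm_nonneg w.2) a2 (n 1)
  have c1 := pow_le_pow_left₀ (norm_nonneg w.1) a1 (n 0)
  have c2 := pow_le_pow_left₀ (norm_nonneg w.2) a2 (n 1)
  have e1 : ‖((n 0 : ℂ) * w.1 ^ (n 0 - 1) * w.2 ^ (n 1)) • ContinuousLinearMap.fst ℂ ℂ ℂ‖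
      ≤ (2 * n 0 * (1/2 : ℝ) ^ (n 0)) * (1/2) ^ (n 1) := by
    rw [norm_smul]
    refine (mul_le_of_le_one_right (norm_nonneg _) (ContinuousLinearMap.norm_fst_le ..)).trans ?_
    rw [norm_mul, norm_mul, norm_pow, norm_pow, Complex.norm_natCast]
    exact mul_le_mul b1 c2 (by positivity) (by positivity)
  have e2 : ‖((n 1 : ℂ) * w.1 ^ (n 0) * w.2 ^ (n 1 - 1)) • ContinuousLinearMap.snd ℂ ℂ ℂ‖
      ≤ (1/2 : ℝ) ^ (n 0) * (2 * n 1 * (1/2) ^ (n 1)) := by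
    rw [norm_smul]
    refine (mul_le_of_le_one_right (norm_nonneg _) (ContinuousLinearMap.norm_snd_le ..)).trans ?_
    rw [norm_mul, norm_mul, norm_pow, norm_pow, Complex.norm_natCast, mul_comm (n 1 : ℝ), mul_assoc]
    exact mul_le_mul c1 b2 (by positivity) (by positivity)
  refine (norm_add_le _ _).trans ((add_le_add e1 e2).trans (le_of_eq ?_))
  unfold dg; push_cast; ring

theorem dterm_le {g : Idx → ℂ} {M : ℝ} (hg : ∀ n, ‖g n‖ ≤ M) (n : Idx) {w : ℂ × ℂ} (hw : ‖w‖ ≤ 1/2) :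
    ‖g n • Dm n w‖ ≤ M * (2 * (dg n * (1/2 : ℝ) ^ dg n)) :=
  by
  rw [norm_smul]
  exact (mul_le_mul (hg n) (norm_Dm_le n hw) (norm_nonneg _) ((norm_nonneg _).trans (hg n)))

theorem dsum {M : ℝ} : Summable (fun n : Idx => M * (2 * (dg n * (1/2 : ℝ) ^ dg n))) :=
  (summable_dg.mul_left 2).mul_left M

/-- derivative of a series -/
noncomputable def DSer (g : Idx → ℂ) (w : ℂ × ℂ) : ℂ × ℂ →L[ℂ] ℂ := ∑' n : Idx, g n • Dm n w

theorem dser_summable {g : Idx → ℂ} {M : ℝ} (hg : ∀ n, ‖g n‖ ≤ M) {w : ℂ × ℂ} (hw : ‖w‖ ≤ 1/2) :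
    Summable (fun n : Idx => g n • Dm n w) :=
  Summable.of_norm_bounded dsum (fun n => dterm_le hg n hw)

theorem ser_hasFDerivAt {g : Idx → ℂ} {M : ℝ} (hg : ∀ n, ‖g n‖ ≤ M) {w : ℂ × ℂ} (hw : ‖w‖ < 1/2) :
    HasFDerivAt (fun w : ℂ × ℂ => Ser g w.1 w.2) (DSer g w) w := by
  unfold Ser DSer
  refine hasFDerivAt_tsum_of_isPreconnected (s := Metric.ball (0 : ℂ × ℂ) (1/2)) (x₀ := 0)
    (f := fun (n : Idx) (w : ℂ × ℂ) => g n • (w.1 ^ (n 0) * w.2 ^ (n 1)))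
    (f' := fun n w => g n • Dm n w) (dsum (M := M)) Metric.isOpen_ball
    (convex_ball _ _).isPreconnected (fun n x _ => (hasFDerivAt_monom n x).const_smul (g n))
    (fun n x hx => dterm_le hg n (by simpa using (mem_ball_zero_iff.1 hx).le)) (by simp)
    (ser_summable hg (by simp) (by simp)) (by simpa using hw)

theorem dser_continuousOn {g : Idx → ℂ} {M : ℝ} (hg : ∀ n, ‖g n‖ ≤ M) :
    ContinuousOn (DSer g) (Metric.ball 0 (1/2)) := by
  unfold DSer
  refine continuousOn_tsum (fun n => ((Dm_cont n).const_smul (g n)).continuousOn) (dsum (M := M))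
    (fun n x hx => dterm_le hg n (by simpa using (mem_ball_zero_iff.1 hx).le))

theorem ser_contDiffAt {g : Idx → ℂ} {M : ℝ} (hg : ∀ n, ‖g n‖ ≤ M) :
    ContDiffAt ℂ 1 (fun w : ℂ × ℂ => Ser g w.1 w.2) 0 := by
  rw [contDiffAt_one_iff]
  exact ⟨DSer g, Metric.ball 0 (1/2), Metric.ball_mem_nhds _ (by norm_num), dser_continuousOn hg,
    fun x hx => ser_hasFDerivAt hg (mem_ball_zero_iff.1 hx)⟩

theorem dser_apply {g : Idx → ℂ} {M : ℝ} (hg : ∀ n, ‖g n‖ ≤ M) {w : ℂ × ℂ} (hw : ‖w‖ ≤ 1/2) (v : ℂ × ℂ) :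
    DSer g w v = ∑' n : Idx, g n * (Dm n w v) :=
  (ContinuousLinearMap.apply ℂ ℂ v).map_tsum (dser_summable hg hw)

theorem dser_euler {g : Idx → ℂ} {M : ℝ} (hg : ∀ n, ‖g n‖ ≤ M) {w : ℂ × ℂ} (hw : ‖w‖ ≤ 1/2) (l₁ l₂ : ℂ) :
    DSer g w (l₁ * w.1, l₂ * w.2) = ∑' n : Idx, ((n 0 * l₁ + n 1 * l₂) * g n) • (w.1 ^ (n 0) * w.2 ^ (n 1)) := by
  rw [dser_apply hg hw]
  refine tsum_congr (fun n => ?_)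
  have h (i : ℕ) (z : ℂ) : (i : ℂ) * z ^ (i - 1) * z = i * z ^ i := by
    cases i with
    | zero => simp
    | succ i => rw [Nat.add_sub_cancel]; ring
  have h0 := h (n 0) w.1
  have h1 := h (n 1) w.2
  simp only [Dm, _root_.add_apply, _root_.smul_apply,
    ContinuousLinearMap.coe_fst', ContinuousLinearMap.coe_snd', smul_eq_mul]
  linear_combination (g n * w.2 ^ (n 1) * l₁) * h0 + (g n * w.1 ^ (n 0) * l₂) * h1

/-- exponent (1,0) -/
noncomputable def e0 : Idx := Finsupp.single 0 1
/-- exponent (0,1) -/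
noncomputable def e1 : Idx := Finsupp.single 1 1

theorem dser_zero {g : Idx → ℂ} {M : ℝ} (hg : ∀ n, ‖g n‖ ≤ M) (v : ℂ × ℂ) :
    DSer g 0 v = g e0 * v.1 + g e1 * v.2 := by
  have hne : e0 ≠ e1 := by
    intro h
    have := DFunLike.congr_fun h 0
    simp [e0, e1] at this
  rw [dser_apply hg (by simp), tsum_eq_sum (s := {e0, e1}), Finset.sum_pair hne]
  · simp [Dm, e0, e1]
  · intro n hn
    simp only [Finset.mem_insert, Finset.mem_singleton, not_or] at hn
    have h0 : ¬ (n 0 = 1 ∧ n 1 = 0) := fun h => hn.1 (idx_ext (by simp [h, e0]) (by simp [h, e0]))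
    have h1 : ¬ (n 0 = 0 ∧ n 1 = 1) := fun h => hn.2 (idx_ext (by simp [h, e1]) (by simp [h, e1]))
    have A : (n 0 : ℂ) * 0 ^ (n 0 - 1) * 0 ^ (n 1) = 0 := by
      by_cases a : n 0 = 0
      · simp [a]
      by_cases b : n 1 = 0
      · have : n 0 - 1 ≠ 0 := by omega
        simp [this]
      · simp [b]
    have B : (n 1 : ℂ) * 0 ^ (n 0) * 0 ^ (n 1 - 1) = 0 := by
      by_cases a : n 1 = 0
      · simp [a]
      by_cases b : n 0 = 0
      · have : n 1 - 1 ≠ 0 := by omega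
        simp [this]
      · simp [b]
    simp only [Dm, Prod.fst_zero, Prod.snd_zero, A, B]
    simp

end PLin

namespace PLin
open Complex MeasureTheory

theorem hasSum_congr' {f g : ℕ → ℂ} {a : ℂ} (h : HasSum f a) (e : ∀ n, g n = f n) : HasSum g a := by
  rwa [show g = f from funext e]

/-- point on the unit circle -/
noncomputable def cm (θ : ℝ) : ℂ := circleMap 0 1 θ

theorem cm_cont : Continuous cm := continuous_circleMap 0 1
theorem cm_norm (θ : ℝ) : ‖cm θ‖ = 1 := by simp [cm]

/-- Cauchy kernel -/
noncomputable def ker (n : ℕ) (θ : ℝ) : ℂ := (cm θ * I) * ((cm θ)⁻¹ ^ n * (cm θ)⁻¹)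

theorem ker_norm (n : ℕ) (θ : ℝ) : ‖ker n θ‖ = 1 := by simp [ker, cm_norm]

theorem ker_cont (n : ℕ) : Continuous (ker n) := by
  have h : Continuous (fun θ => (cm θ)⁻¹) :=
    cm_cont.inv₀ (fun θ h => by have := cm_norm θ; rw [h] at this; simp at this)
  unfold ker
  exact (cm_cont.mul continuous_const).mul ((h.pow n).mul h)

/-- Taylor coefficient from boundary values -/
noncomputable def cc (G : ℝ → ℂ) (n : ℕ) : ℂ := (2 * Real.pi * I : ℂ)⁻¹ * ∫ θ in (0:ℝ)..2 * Real.pi, ker n θ * G θ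

theorem cc_norm_le {G : ℝ → ℂ} {M : ℝ} (hG : ∀ θ, ‖G θ‖ ≤ M) (n : ℕ) : ‖cc G n‖ ≤ M := by
  have h := intervalIntegral.norm_integral_le_of_norm_le_const (a := 0) (b := 2 * Real.pi) (C := M)
    (f := fun θ => ker n θ * G θ) (fun θ _ => by rw [norm_mul, ker_norm, one_mul]; exact hG θ)
  rw [sub_zero, abs_of_pos Real.two_pi_pos] at h
  unfold cc
  rw [norm_mul, norm_inv]
  have e : ‖(2 * Real.pi * I : ℂ)‖ = 2 * Real.pi := by
    simp [abs_of_pos Real.pi_pos]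
  rw [e]
  calc _ ≤ (2 * Real.pi)⁻¹ * (M * (2 * Real.pi)) := by gcongr
    _ = M := by field_simp

theorem cc_hasSum {G : ℂ → ℂ} (hG : DifferentiableOn ℂ G (Metric.closedBall 0 1)) {z : ℂ} (hz : ‖z‖ < 1) :
    HasSum (fun n : ℕ => cc (fun θ => G (cm θ)) n * z ^ n) (G z) := by
  have h := (DifferentiableOn.hasFPowerSeriesOnBall (R := 1) (c := 0) (by simpa using hG) one_pos).hasSum
    (y := z) (by
      rw [mem_eball_zero_iff, enorm_eq_nnnorm]; exact_mod_cast hz)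
  rw [zero_add] at h
  refine hasSum_congr' h (fun n => ?_)
  rw [cauchyPowerSeries_apply]
  simp only [circleIntegral, cc, smul_eq_mul, NNReal.coe_one, sub_zero, deriv_circleMap]
  rw [mul_assoc, ← intervalIntegral.integral_mul_const]
  congr 1
  apply intervalIntegral.integral_congr
  intro θ _
  simp only [ker, cm, div_eq_mul_inv, mul_pow]
  ring

theorem taylor2 {F : ℂ × ℂ → ℂ} (hF : DifferentiableOn ℂ F (Metric.closedBall 0 1)) :
    ∃ (g : Idx → ℂ) (M : ℝ), (∀ n, ‖g n‖ ≤ M) ∧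
      ∀ x y : ℂ, ‖x‖ < 1 → ‖y‖ < 1 → F (x, y) = Ser g x y := by
  obtain ⟨M, hM⟩ := (isCompact_closedBall (0 : ℂ × ℂ) 1).exists_bound_of_continuousOn hF.continuousOn
  have hmem {x y : ℂ} (hx : ‖x‖ ≤ 1) (hy : ‖y‖ ≤ 1) : (x, y) ∈ Metric.closedBall (0 : ℂ × ℂ) 1 := by
    rw [mem_closedBall_zero_iff, Prod.norm_mk]; exact max_le hx hy
  have hM0 : 0 ≤ M := (norm_nonneg _).trans (hM 0 (by simp))
  -- slices
  have hs1 {y : ℂ} (hy : ‖y‖ ≤ 1) : DifferentiableOn ℂ (fun x => F (x, y)) (Metric.closedBall 0 1) :=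
    hF.comp (by fun_prop) (fun x hx => hmem (by simpa using hx) hy)
  have hs2 {x : ℂ} (hx : ‖x‖ ≤ 1) : DifferentiableOn ℂ (fun y => F (x, y)) (Metric.closedBall 0 1) :=
    hF.comp (by fun_prop) (fun y hy => hmem hx (by simpa using hy))
  let C (j : ℕ) (θ : ℝ) : ℂ := cc (fun φ => F (cm θ, cm φ)) j
  have hCb (j : ℕ) (θ : ℝ) : ‖C j θ‖ ≤ M :=
    cc_norm_le (fun φ => hM _ (hmem (cm_norm _).le (cm_norm _).le)) j
  have hCc (j : ℕ) : Continuous (C j) := by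
    have hc : Continuous (fun p : ℝ × ℝ => F (cm p.1, cm p.2)) :=
      hF.continuousOn.comp_continuous ((cm_cont.comp continuous_fst).prodMk (cm_cont.comp continuous_snd))
        (fun p => hmem (cm_norm _).le (cm_norm _).le)
    have := intervalIntegral.continuous_parametric_intervalIntegral_of_continuous' (μ := volume)
      (f := fun θ φ => ker j φ * F (cm θ, cm φ))
      (((ker_cont j).comp continuous_snd).mul hc) 0 (2 * Real.pi)
    exact continuous_const.mul this
  let G (p : ℕ × ℕ) : ℂ := cc (C p.2) p.1
  have hGb (p : ℕ × ℕ) : ‖G p‖ ≤ M := cc_norm_le (hCb p.2) p.1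
  have hinner (i : ℕ) {y : ℂ} (hy : ‖y‖ < 1) :
      HasSum (fun j => G (i, j) * y ^ j) (cc (fun θ => F (cm θ, y)) i) := by
    have h := intervalIntegral.hasSum_integral_of_dominated_convergence (μ := volume) (a := 0) (b := 2 * Real.pi)
      (F := fun j θ => ker i θ * (C j θ * y ^ j)) (f := fun θ => ker i θ * F (cm θ, y))
      (fun j _ => M * ‖y‖ ^ j)
      (fun j => ((ker_cont i).mul ((hCc j).mul continuous_const)).aestronglyMeasurable)
      (fun j => Filter.Eventually.of_forall (fun θ _ => by
        rw [norm_mul, ker_norm, one_mul, norm_mul, norm_pow]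
        exact mul_le_mul_of_nonneg_right (hCb j θ) (by positivity)))
      (Filter.Eventually.of_forall (fun θ _ => (summable_geometric_of_lt_one (norm_nonneg _) hy).mul_left M))
      (by simp)
      (Filter.Eventually.of_forall (fun θ _ => (cc_hasSum (hs2 (cm_norm θ).le) hy).mul_left _))
    have h2 := h.mul_left (2 * Real.pi * I : ℂ)⁻¹
    refine hasSum_congr' h2 (fun j => ?_)
    simp only [G]
    rw [cc, mul_assoc, ← intervalIntegral.integral_mul_const]
    simp only [mul_assoc]
  refine ⟨fun n => G (idxE n), M, fun n => hGb _, fun x y hx hy => ?_⟩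
  have hsum : Summable (fun n : Idx => G (idxE n) • (x ^ (n 0) * y ^ (n 1))) :=
    ser_summable (fun n => hGb (idxE n)) hx hy
  have hs : HasSum (fun p : ℕ × ℕ => G p • (x ^ p.1 * y ^ p.2)) (Ser (fun n => G (idxE n)) x y) :=
    (Equiv.hasSum_iff idxE).1 hsum.hasSum
  have h3 := hs.prod_fiberwise (g := fun i => cc (fun θ => F (cm θ, y)) i * x ^ i) (fun i => by
    have := (hinner i hy).mul_right (x ^ i)
    refine hasSum_congr' this (fun j => ?_)
    simp only [smul_eq_mul]; ring)
  exact (cc_hasSum (hs1 hy.le) hx).unique h3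

end PLin

namespace PLin

theorem divisor_lower {l₁ l₂ : ℂ} (hP : PoincareDomain l₁ l₂) :
    ∃ δ > 0, ∀ n : Idx, δ * dg n ≤ ‖(n 0 : ℂ) * l₁ + n 1 * l₂‖ := by
  have hc : IsClosed (segment ℝ l₁ l₂) := by
    rw [segment_eq_image]
    exact (isCompact_Icc.image (by fun_prop)).isClosed
  obtain ⟨δ, hδ, hb⟩ := Metric.isOpen_iff.1 hc.isOpen_compl 0 hP
  refine ⟨δ, hδ, fun n => ?_⟩
  by_cases hn : dg n = 0
  · simp [hn]
  have hd : (0:ℝ) < dg n := by exact_mod_cast Nat.pos_of_ne_zero hn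
  have hmem : ((n 0 / dg n : ℝ) • l₁ + (n 1 / dg n : ℝ) • l₂) ∈ segment ℝ l₁ l₂ := by
    refine ⟨n 0 / dg n, n 1 / dg n, by positivity, by positivity, ?_, rfl⟩
    rw [← add_div, div_eq_one_iff_eq hd.ne']
    simp [dg]
  have h2 : δ ≤ ‖((n 0 / dg n : ℝ) • l₁ + (n 1 / dg n : ℝ) • l₂)‖ := by
    by_contra hlt
    push Not at hlt
    exact hb (mem_ball_zero_iff.2 hlt) hmem
  have e : (n 0 : ℂ) * l₁ + n 1 * l₂ = (dg n : ℝ) • ((n 0 / dg n : ℝ) • l₁ + (n 1 / dg n : ℝ) • l₂) := by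
    have : (dg n : ℂ) ≠ 0 := by exact_mod_cast hn
    simp only [Complex.real_smul]
    push_cast
    field_simp
  rw [e, norm_smul, Real.norm_of_nonneg hd.le, mul_comm]
  exact mul_le_mul_of_nonneg_left h2 hd.le

/-- first multiplier -/
noncomputable def mu1 (l₁ l₂ : ℂ) (n : Idx) : ℂ := if dg n ≤ 0 then 0 else ((n 0 : ℂ) * l₁ + n 1 * l₂)⁻¹
/-- second multiplier -/
noncomputable def mu2 (l₁ l₂ : ℂ) (n : Idx) : ℂ := if dg n ≤ 1 then 0 else ((n 0 : ℂ) * l₁ + n 1 * l₂ - l₂)⁻¹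

theorem mu1_bound {l₁ l₂ : ℂ} (hP : PoincareDomain l₁ l₂) : ∃ E : ℝ, ∀ n, ‖mu1 l₁ l₂ n‖ ≤ E := by
  obtain ⟨δ, hδ, h⟩ := divisor_lower hP
  refine ⟨δ⁻¹, fun n => ?_⟩
  unfold mu1
  split_ifs with hn
  · simpa using hδ.le
  · rw [norm_inv]
    apply inv_anti₀ hδ
    have : (1:ℝ) ≤ dg n := by exact_mod_cast (by omega : 1 ≤ dg n)
    nlinarith [h n]

theorem mu1_mul {l₁ l₂ : ℂ} (hP : PoincareDomain l₁ l₂) {n : Idx} (hn : ¬ dg n ≤ 0) :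
    ((n 0 : ℂ) * l₁ + n 1 * l₂) * mu1 l₁ l₂ n = 1 := by
  obtain ⟨δ, hδ, h⟩ := divisor_lower hP
  rw [mu1, if_neg hn]
  apply mul_inv_cancel₀
  rw [← norm_pos_iff]
  have : (1:ℝ) ≤ dg n := by exact_mod_cast (by omega : 1 ≤ dg n)
  nlinarith [h n]

theorem finite_dg (N : ℕ) : {n : Idx | dg n ≤ N}.Finite := by
  have : {n : Idx | dg n ≤ N} ⊆ idxE ⁻¹' (Set.Iic N ×ˢ Set.Iic N) := by
    intro n hn
    simp only [Set.mem_ofPred_eq, dg] at hn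
    simp only [Set.mem_preimage, Set.mem_prod, Set.mem_Iic, idxE_fst, idxE_snd]
    omega
  exact (((Set.finite_Iic N).prod (Set.finite_Iic N)).preimage idxE.injective.injOn).subset this

theorem mu2_bound {l₁ l₂ : ℂ} (hP : PoincareDomain l₁ l₂) : ∃ E : ℝ, ∀ n, ‖mu2 l₁ l₂ n‖ ≤ E := by
  obtain ⟨δ, hδ, h⟩ := divisor_lower hP
  obtain ⟨N, hN⟩ := exists_nat_gt ((‖l₂‖ + 1) / δ)
  obtain ⟨C, hC⟩ := ((finite_dg N).image (fun n => ‖mu2 l₁ l₂ n‖)).bddAbove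
  refine ⟨max C 1, fun n => ?_⟩
  by_cases hn : dg n ≤ N
  · exact (hC (Set.mem_image_of_mem _ hn)).trans (le_max_left _ _)
  refine le_trans ?_ (le_max_right _ _)
  unfold mu2
  split_ifs with h1
  · simp
  rw [norm_inv]
  apply inv_le_one_of_one_le₀
  have h3 : (N:ℝ) ≤ dg n := by exact_mod_cast (by omega : N ≤ dg n)
  have h4 : ‖l₂‖ + 1 < δ * N := by rwa [div_lt_iff₀' hδ] at hN
  have h5 := norm_sub_norm_le ((n 0 : ℂ) * l₁ + n 1 * l₂) l₂
  nlinarith [h n, mul_le_mul_of_nonneg_left h3 hδ.le]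

theorem mu2_mul {l₁ l₂ : ℂ} (hR : ¬ Resonant l₁ l₂) {n : Idx} (hn : ¬ dg n ≤ 1) :
    ((n 0 : ℂ) * l₁ + n 1 * l₂ - l₂) * mu2 l₁ l₂ n = 1 := by
  rw [mu2, if_neg hn]
  apply mul_inv_cancel₀
  intro h
  exact hR ⟨n 0, n 1, by unfold dg at hn; omega, Or.inr (sub_eq_zero.1 h).symm⟩

end PLin

namespace PLin

/-- first coordinate of the scaled map -/
noncomputable def XX (s : ℝ) (a : WA) : WA := (s : ℂ) • (mono e0 * (1 + a))
/-- second coordinate of the scaled map -/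
noncomputable def YY (s : ℝ) (b : WA) : WA := (s : ℂ) • (mono e1 + b)

theorem norm_XX {s : ℝ} (hs : 0 ≤ s) {a : WA} (ha : ‖a‖ ≤ 1) : ‖XX s a‖ ≤ 2 * s := by
  have h1 : ‖1 + a‖ ≤ 2 := by
    have := norm_add_le 1 a
    rw [norm_one] at this; linarith
  have h2 : ‖mono e0 * (1 + a)‖ ≤ 2 := by
    have := norm_mul_le (mono e0) (1 + a)
    rw [norm_mono] at this; linarith
  rw [XX, norm_smul, Complex.norm_of_nonneg hs]
  nlinarith

theorem norm_YY {s : ℝ} (hs : 0 ≤ s) {b : WA} (hb : ‖b‖ ≤ 1) : ‖YY s b‖ ≤ 2 * s := by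
  have h1 : ‖mono e1 + b‖ ≤ 2 := by
    have := norm_add_le (mono e1) b
    rw [norm_mono] at this; linarith
  rw [YY, norm_smul, Complex.norm_of_nonneg hs]
  nlinarith

theorem XX_sub {s : ℝ} (hs : 0 ≤ s) (a a' : WA) : ‖XX s a - XX s a'‖ ≤ s * ‖a - a'‖ := by
  have e : XX s a - XX s a' = (s : ℂ) • (mono e0 * (a - a')) := by
    unfold XX; rw [← smul_sub]; congr 1; ring
  rw [e, norm_smul, Complex.norm_of_nonneg hs]
  have := norm_mul_le (mono e0) (a - a')
  rw [norm_mono, one_mul] at this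
  exact mul_le_mul_of_nonneg_left this hs

theorem YY_sub {s : ℝ} (hs : 0 ≤ s) (b b' : WA) : ‖YY s b - YY s b'‖ ≤ s * ‖b - b'‖ := by
  have e : YY s b - YY s b' = (s : ℂ) • (b - b') := by
    unfold YY; rw [← smul_sub]; congr 1; ring
  rw [e, norm_smul, Complex.norm_of_nonneg hs]

section fix
variable {k hc : Idx → ℂ} {M : ℝ}

/-- right-hand side, first component -/
noncomputable def R1 (k : Idx → ℂ) (s : ℝ) (p : WA × WA) : WA := (1 + p.1) * Ser k (XX s p.1) (YY s p.2)
/-- right-hand side, second component -/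
noncomputable def R2 (hc : Idx → ℂ) (s : ℝ) (p : WA × WA) : WA := ((s⁻¹ : ℝ) : ℂ) • Ser hc (XX s p.1) (YY s p.2)

theorem ser_diff (hk : ∀ n, ‖k n‖ ≤ M) (m : ℕ) (hk0 : ∀ n, dg n ≤ m → k n = 0) {s : ℝ} (hs0 : 0 < s) (hs : s ≤ 1/8)
    {p q : WA × WA} (hp : ‖p‖ ≤ 1) (hq : ‖q‖ ≤ 1) :
    ‖Ser k (XX s p.1) (YY s p.2) - Ser k (XX s q.1) (YY s q.2)‖ ≤ lipC M m * (2 * s) ^ m * (2 * s * ‖p - q‖) := by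
  have hM : 0 ≤ M := (norm_nonneg _).trans (hk 0)
  have h1 := ser_lip hk m hk0 (s := 2 * s) (by linarith) (by linarith)
    (norm_XX hs0.le ((norm_fst_le p).trans hp)) (norm_XX hs0.le ((norm_fst_le q).trans hq))
    (norm_YY hs0.le ((norm_snd_le p).trans hp)) (norm_YY hs0.le ((norm_snd_le q).trans hq))
  refine h1.trans (mul_le_mul_of_nonneg_left ?_ (mul_nonneg (lipC_nonneg hM m) (by positivity)))
  have h2 := XX_sub hs0.le p.1 q.1
  have h3 := YY_sub hs0.le p.2 q.2
  have h4 : ‖p.1 - q.1‖ ≤ ‖p - q‖ := norm_fst_le (p - q)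
  have h5 : ‖p.2 - q.2‖ ≤ ‖p - q‖ := norm_snd_le (p - q)
  nlinarith

theorem ser_size (hk : ∀ n, ‖k n‖ ≤ M) (m : ℕ) (hk0 : ∀ n, dg n ≤ m → k n = 0) {s : ℝ} (hs0 : 0 < s) (hs : s ≤ 1/8)
    {p : WA × WA} (hp : ‖p‖ ≤ 1) :
    ‖Ser k (XX s p.1) (YY s p.2)‖ ≤ lipC M m * (2 * s) ^ m * (4 * s) := by
  have hM : 0 ≤ M := (norm_nonneg _).trans (hk 0)
  have hX := norm_XX hs0.le ((norm_fst_le p).trans hp)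
  have hY := norm_YY hs0.le ((norm_snd_le p).trans hp)
  have h1 := ser_lip hk m hk0 (s := 2 * s) (by linarith) (by linarith) hX
    (x' := 0) (y' := 0) (by rw [norm_zero]; linarith) hY (by rw [norm_zero]; linarith)
  rw [ser_zero, hk0 0 (by simp [dg]), zero_smul, sub_zero, sub_zero, sub_zero] at h1
  refine h1.trans (mul_le_mul_of_nonneg_left (by linarith) (mul_nonneg (lipC_nonneg hM m) (by positivity)))

theorem R1_diff (hk : ∀ n, ‖k n‖ ≤ M) (hk0 : ∀ n, dg n ≤ 0 → k n = 0) {s : ℝ} (hs0 : 0 < s) (hs : s ≤ 1/8)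
    {p q : WA × WA} (hp : ‖p‖ ≤ 1) (hq : ‖q‖ ≤ 1) : ‖R1 k s p - R1 k s q‖ ≤ 8 * lipC M 0 * s * ‖p - q‖ := by
  have hM : 0 ≤ M := (norm_nonneg _).trans (hk 0)
  have hL := lipC_nonneg hM 0
  have h1 := ser_diff hk 0 hk0 hs0 hs hp hq
  have h2 := ser_size hk 0 hk0 hs0 hs hq
  have e : R1 k s p - R1 k s q = (1 + p.1) * (Ser k (XX s p.1) (YY s p.2) - Ser k (XX s q.1) (YY s q.2))
      + (p.1 - q.1) * Ser k (XX s q.1) (YY s q.2) := by unfold R1; ring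
  have h3 : ‖1 + p.1‖ ≤ 2 := by
    have := norm_add_le 1 p.1
    rw [norm_one] at this; linarith [(norm_fst_le p).trans hp]
  have h4 : ‖p.1 - q.1‖ ≤ ‖p - q‖ := norm_fst_le (p - q)
  rw [e]
  rw [pow_zero, mul_one] at h1 h2
  calc _ ≤ ‖1 + p.1‖ * ‖Ser k (XX s p.1) (YY s p.2) - Ser k (XX s q.1) (YY s q.2)‖ +
        ‖p.1 - q.1‖ * ‖Ser k (XX s q.1) (YY s q.2)‖ :=
        (norm_add_le _ _).trans (add_le_add (norm_mul_le _ _) (norm_mul_le _ _))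
    _ ≤ 2 * (lipC M 0 * (2 * s * ‖p - q‖)) + ‖p - q‖ * (lipC M 0 * (4 * s)) := by gcongr
    _ = _ := by ring

theorem R1_size (hk : ∀ n, ‖k n‖ ≤ M) (hk0 : ∀ n, dg n ≤ 0 → k n = 0) {s : ℝ} (hs0 : 0 < s) (hs : s ≤ 1/8)
    {p : WA × WA} (hp : ‖p‖ ≤ 1) : ‖R1 k s p‖ ≤ 8 * lipC M 0 * s := by
  have h2 := ser_size hk 0 hk0 hs0 hs hp
  have h3 : ‖1 + p.1‖ ≤ 2 := by
    have := norm_add_le 1 p.1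
    rw [norm_one] at this; linarith [(norm_fst_le p).trans hp]
  rw [pow_zero, mul_one] at h2
  calc _ ≤ ‖1 + p.1‖ * ‖Ser k (XX s p.1) (YY s p.2)‖ := norm_mul_le _ _
    _ ≤ 2 * (lipC M 0 * (4 * s)) := by gcongr
    _ = _ := by ring

theorem R2_diff (hk : ∀ n, ‖hc n‖ ≤ M) (hk0 : ∀ n, dg n ≤ 1 → hc n = 0) {s : ℝ} (hs0 : 0 < s) (hs : s ≤ 1/8)
    {p q : WA × WA} (hp : ‖p‖ ≤ 1) (hq : ‖q‖ ≤ 1) : ‖R2 hc s p - R2 hc s q‖ ≤ 8 * lipC M 1 * s * ‖p - q‖ := by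
  have hM : 0 ≤ M := (norm_nonneg _).trans (hk 0)
  have hL := lipC_nonneg hM 1
  have h1 := ser_diff hk 1 hk0 hs0 hs hp hq
  unfold R2
  rw [← smul_sub, norm_smul, Complex.norm_of_nonneg (by positivity)]
  calc _ ≤ s⁻¹ * (lipC M 1 * (2 * s) ^ 1 * (2 * s * ‖p - q‖)) := by gcongr
    _ = 4 * (lipC M 1 * s * ‖p - q‖) := by field_simp; ring
    _ ≤ 8 * (lipC M 1 * s * ‖p - q‖) := by gcongr; norm_num
    _ = _ := by ring

theorem R2_size (hk : ∀ n, ‖hc n‖ ≤ M) (hk0 : ∀ n, dg n ≤ 1 → hc n = 0) {s : ℝ} (hs0 : 0 < s) (hs : s ≤ 1/8)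
    {p : WA × WA} (hp : ‖p‖ ≤ 1) : ‖R2 hc s p‖ ≤ 8 * lipC M 1 * s := by
  have h1 := ser_size hk 1 hk0 hs0 hs hp
  unfold R2
  rw [norm_smul, Complex.norm_of_nonneg (by positivity)]
  calc _ ≤ s⁻¹ * (lipC M 1 * (2 * s) ^ 1 * (4 * s)) := by gcongr
    _ = _ := by field_simp; ring

theorem exists_fixed (hk : ∀ n, ‖k n‖ ≤ M) (hk0 : ∀ n, dg n ≤ 0 → k n = 0)
    (hh : ∀ n, ‖hc n‖ ≤ M) (hh0 : ∀ n, dg n ≤ 1 → hc n = 0)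
    {m1 m2 : Idx → ℂ} {E : ℝ} (hm1 : ∀ n, ‖m1 n‖ ≤ E) (hm2 : ∀ n, ‖m2 n‖ ≤ E) :
    ∃ s : ℝ, 0 < s ∧ s ≤ 1/8 ∧ ∃ p : WA × WA, ‖p‖ ≤ 1 ∧ p.1 = diag m1 E hm1 (R1 k s p) ∧
      p.2 = diag m2 E hm2 (R2 hc s p) := by
  have hM : 0 ≤ M := (norm_nonneg _).trans (hk 0)
  have hE : 0 ≤ E := (norm_nonneg _).trans (hm1 0)
  have hL0 := lipC_nonneg hM 0
  have hL1 := lipC_nonneg hM 1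
  set L := lipC M 0 + lipC M 1 with hL
  have hLn : 0 ≤ L := by positivity
  obtain ⟨s, hs0, hs1, hs2⟩ : ∃ s : ℝ, 0 < s ∧ s ≤ 1/8 ∧ E * (8 * L * s) ≤ 1/2 := by
    refine ⟨min (1/8) (1 / (16 * E * L + 1)), by positivity, min_le_left _ _, ?_⟩
    have h1 : min (1/8) (1 / (16 * E * L + 1)) ≤ 1 / (16 * E * L + 1) := min_le_right _ _
    have h2 : (16 * E * L + 1) * (1 / (16 * E * L + 1)) = 1 := by field_simp
    have h3 : 0 ≤ E * L := by positivity
    have h4 : 0 ≤ 1 / (16 * E * L + 1) := by positivity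
    nlinarith [mul_le_mul_of_nonneg_left h1 h3]
  refine ⟨s, hs0, hs1, ?_⟩
  have hc0 : E * (8 * lipC M 0 * s) ≤ 1/2 := le_trans (by gcongr; linarith) hs2
  have hc1 : E * (8 * lipC M 1 * s) ≤ 1/2 := le_trans (by gcongr; linarith) hs2
  let T : WA × WA → WA × WA := fun p => (diag m1 E hm1 (R1 k s p), diag m2 E hm2 (R2 hc s p))
  have hmaps : Set.MapsTo T (Metric.closedBall 0 1) (Metric.closedBall 0 1) := by
    intro p hp
    rw [mem_closedBall_zero_iff] at hp ⊢
    refine max_le ?_ ?_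
    · have h1 := norm_diag_le m1 E hm1 (R1 k s p)
      have h2 := mul_le_mul_of_nonneg_left (R1_size hk hk0 hs0 hs1 hp) hE
      exact (h1.trans h2).trans (by linarith)
    · have h1 := norm_diag_le m2 E hm2 (R2 hc s p)
      have h2 := mul_le_mul_of_nonneg_left (R2_size hh hh0 hs0 hs1 hp) hE
      exact (h1.trans h2).trans (by linarith)
  have hcontr : ContractingWith (1/2) (hmaps.restrict T _ _) := by
    refine ⟨by norm_num, LipschitzWith.of_dist_le_mul ?_⟩
    rintro ⟨p, hp⟩ ⟨q, hq⟩
    rw [mem_closedBall_zero_iff] at hp hq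
    change dist (T p) (T q) ≤ _ * dist p q
    rw [dist_eq_norm, dist_eq_norm]
    have hh2 : ((1/2 : NNReal) : ℝ) = 1/2 := by norm_num
    rw [hh2]
    refine max_le ?_ ?_
    · change ‖diag m1 E hm1 (R1 k s p) - diag m1 E hm1 (R1 k s q)‖ ≤ _
      rw [diag_sub]
      have h1 := norm_diag_le m1 E hm1 (R1 k s p - R1 k s q)
      have h2 := mul_le_mul_of_nonneg_left (R1_diff hk hk0 hs0 hs1 hp hq) hE
      have h3 := mul_le_mul_of_nonneg_right hc0 (norm_nonneg (p - q))
      linarith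
    · change ‖diag m2 E hm2 (R2 hc s p) - diag m2 E hm2 (R2 hc s q)‖ ≤ _
      rw [diag_sub]
      have h1 := norm_diag_le m2 E hm2 (R2 hc s p - R2 hc s q)
      have h2 := mul_le_mul_of_nonneg_left (R2_diff hh hh0 hs0 hs1 hp hq) hE
      have h3 := mul_le_mul_of_nonneg_right hc1 (norm_nonneg (p - q))
      linarith
  obtain ⟨p, hp, hfix, -⟩ := hcontr.exists_fixedPoint' Metric.isClosed_closedBall.isComplete hmaps
    (x := 0) (by simp) (edist_ne_top _ _)
  refine ⟨p, mem_closedBall_zero_iff.1 hp, ?_, ?_⟩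
  · exact (congrArg Prod.fst hfix).symm
  · exact (congrArg Prod.snd hfix).symm

end fix

/-- The two linearization equations, at the level of holomorphic functions. -/
theorem exists_solution {l₁ l₂ : ℂ} (hP : PoincareDomain l₁ l₂) (hR : ¬ Resonant l₁ l₂)
    {k hc : Idx → ℂ} {M : ℝ} (hk : ∀ n, ‖k n‖ ≤ M) (hk0 : ∀ n, dg n ≤ 0 → k n = 0)
    (hh : ∀ n, ‖hc n‖ ≤ M) (hh0 : ∀ n, dg n ≤ 1 → hc n = 0) :
    ∃ s : ℝ, 0 < s ∧ ∃ (a b : Idx → ℂ) (N : ℝ), (∀ n, ‖a n‖ ≤ N) ∧ (∀ n, ‖b n‖ ≤ N) ∧ a 0 = 0 ∧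
      (∀ n, dg n ≤ 1 → b n = 0) ∧
      ∀ w : ℂ × ℂ, ‖w‖ < 1/2 →
        ‖s * (w.1 * (1 + Ser a w.1 w.2))‖ < 1 ∧ ‖s * (w.2 + Ser b w.1 w.2)‖ < 1 ∧
        DSer a w (l₁ * w.1, l₂ * w.2) = (1 + Ser a w.1 w.2) *
          Ser k (s * (w.1 * (1 + Ser a w.1 w.2))) (s * (w.2 + Ser b w.1 w.2)) ∧
        s * (DSer b w (l₁ * w.1, l₂ * w.2) - l₂ * Ser b w.1 w.2) =
          Ser hc (s * (w.1 * (1 + Ser a w.1 w.2))) (s * (w.2 + Ser b w.1 w.2)) := by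
  obtain ⟨E1, hE1⟩ := mu1_bound hP
  obtain ⟨E2, hE2⟩ := mu2_bound hP
  obtain ⟨s, hs0, hs1, ⟨a, b⟩, hp, ha, hb⟩ := exists_fixed hk hk0 hh hh0
    (fun n => (hE1 n).trans (le_max_left E1 E2)) (fun n => (hE2 n).trans (le_max_right E1 E2))
  simp only at ha hb
  have hna : ‖a‖ ≤ 1 := (norm_fst_le _).trans hp
  have hnb : ‖b‖ ≤ 1 := (norm_snd_le _).trans hp
  have hX := norm_XX hs0.le hna
  have hY := norm_YY hs0.le hnb
  have hX1 : ‖XX s a‖ < 1 := by linarith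
  have hY1 : ‖YY s b‖ < 1 := by linarith
  have hca (n : Idx) : cf a n = mu1 l₁ l₂ n * cf (R1 k s (a, b)) n := by
    conv_lhs => rw [ha]
    rfl
  have hcb (n : Idx) : cf b n = mu2 l₁ l₂ n * cf (R2 hc s (a, b)) n := by
    conv_lhs => rw [hb]
    rfl
  have hca0 : cf a 0 = 0 := by rw [hca, mu1, if_pos (by simp [dg]), zero_mul]
  have hcb0 (n : Idx) (hn : dg n ≤ 1) : cf b n = 0 := by rw [hcb, mu2, if_pos hn, zero_mul]
  have hX0 : cf (XX s a) 0 = 0 := by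
    have h1 : (1 : ℕ∞) ≤ (toMv (mono e0)).order := one_le_order (by
      classical
      rw [cf_mono, if_neg]; intro h
      have := DFunLike.congr_fun h 0
      simp [e0] at this)
    have h2 : cf (mono e0 * (1 + a)) 0 = 0 := by
      apply cf_zero_of_order (k := 1) _ (by simp [dg])
      rw [toMv_mul]
      exact (le_trans (by simpa using le_add_right h1) MvPowerSeries.le_order_mul)
    rw [XX, cf_smul, Pi.smul_apply, h2, smul_zero]
  have hY0 : cf (YY s b) 0 = 0 := by
    classical
    have : (0 : Idx) ≠ e1 := by
      intro h
      have := DFunLike.congr_fun h 1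
      simp [e1] at this
    rw [YY, cf_smul, Pi.smul_apply, cf_add, Pi.add_apply, cf_mono, if_neg this, hcb0 0 (by simp [dg])]
    simp
  have hR1 (n : Idx) (hn : dg n ≤ 0) : cf (R1 k s (a, b)) n = 0 := by
    have h1 : (1 : ℕ∞) ≤ (toMv (Ser k (XX s a) (YY s b))).order :=
      one_le_order (cf_ser_zero hk 0 hk0 hX1 hY1 hX0 hY0 (by simp [dg]))
    apply cf_zero_of_order (k := 1) _ (by omega)
    rw [R1, toMv_mul]
    exact (le_trans (by simpa using le_add_left h1) MvPowerSeries.le_order_mul)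
  have hR2 (n : Idx) (hn : dg n ≤ 1) : cf (R2 hc s (a, b)) n = 0 := by
    rw [R2, cf_smul, Pi.smul_apply, cf_ser_zero hh 1 hh0 hX1 hY1 hX0 hY0 hn, smul_zero]
  have hna' : ∀ n, ‖cf a n‖ ≤ 1 := fun n => (norm_cf_le a n).trans hna
  have hnb' : ∀ n, ‖cf b n‖ ≤ 1 := fun n => (norm_cf_le b n).trans hnb
  refine ⟨s, hs0, cf a, cf b, 1, hna', hnb', hca0, hcb0, fun w hw => ?_⟩
  have hw1 : ‖w‖ ≤ 1 := by linarith
  have eX : ev w (XX s a) = s * (w.1 * (1 + Ser (cf a) w.1 w.2)) := by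
    rw [XX, ev_smul, ev_mul w hw1, ev_add w hw1, ev_one, ev_mono]
    simp [e0, ev]
  have eY : ev w (YY s b) = s * (w.2 + Ser (cf b) w.1 w.2) := by
    rw [YY, ev_smul, ev_add w hw1, ev_mono]
    simp [e1, ev]
  have A1 : DSer (cf a) w (l₁ * w.1, l₂ * w.2) = ev w (R1 k s (a, b)) := by
    rw [dser_euler hna' hw.le, ev, Ser]
    refine tsum_congr (fun n => ?_)
    congr 1
    by_cases hn : dg n ≤ 0
    · rw [hR1 n hn, hca n, hR1 n hn]; simp
    · rw [hca n, ← mul_assoc, mu1_mul hP hn, one_mul]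
  have A2 : DSer (cf b) w (l₁ * w.1, l₂ * w.2) = ev w (R2 hc s (a, b)) + l₂ * ev w b := by
    rw [← ev_smul, ← ev_add w hw1, dser_euler hnb' hw.le, ev, Ser]
    refine tsum_congr (fun n => ?_)
    congr 1
    rw [cf_add, cf_smul, Pi.add_apply, Pi.smul_apply, smul_eq_mul]
    by_cases hn : dg n ≤ 1
    · rw [hR2 n hn, hcb0 n hn]; simp
    · have := mu2_mul hR hn
      rw [hcb n]
      linear_combination (cf (R2 hc s (a, b)) n) * this
  refine ⟨?_, ?_, ?_, ?_⟩
  · rw [← eX]; exact (ev_norm_le w hw1 _).trans_lt hX1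
  · rw [← eY]; exact (ev_norm_le w hw1 _).trans_lt hY1
  · rw [A1, R1, ev_mul w hw1, ev_add w hw1, ev_one, ev_ser w hw1 hk hX1 hY1, eX, eY]; rfl
  · rw [A2, ← eX, ← eY, ← ev_ser w hw1 hh hX1 hY1, R2, ev_smul]
    have : (s : ℂ) ≠ 0 := by exact_mod_cast hs0.ne'
    change s * (_ + l₂ * ev w b - l₂ * ev w b) = _
    push_cast
    field_simp
    ring

end PLin

namespace PLin

theorem bihol {Ψ : ℂ × ℂ → ℂ × ℂ} (hc : ContDiffAt ℂ 1 Ψ 0)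
    (hd : HasFDerivAt Ψ (ContinuousLinearMap.id ℂ (ℂ × ℂ)) 0) (hz : Ψ 0 = 0)
    {B : Set (ℂ × ℂ)} (hB : IsOpen B) (hB0 : (0 : ℂ × ℂ) ∈ B) :
    ∃ (V W : Set (ℂ × ℂ)) (Φ : ℂ × ℂ → ℂ × ℂ), IsOpen V ∧ IsOpen W ∧ (0 : ℂ × ℂ) ∈ V ∧ (0 : ℂ × ℂ) ∈ W ∧
      V ⊆ B ∧ DifferentiableOn ℂ Φ W ∧ Set.BijOn Ψ V W ∧ (∀ p ∈ V, Φ (Ψ p) = p) ∧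
      (∀ q ∈ W, Ψ (Φ q) = q) := by
  have hd2 : HasFDerivAt Ψ ((ContinuousLinearEquiv.refl ℂ (ℂ × ℂ) : ℂ × ℂ →L[ℂ] ℂ × ℂ)) 0 := hd
  set e := hc.toOpenPartialHomeomorph Ψ hd2 one_ne_zero with he
  have hcoe : (e : ℂ × ℂ → ℂ × ℂ) = Ψ := rfl
  have hs : (0 : ℂ × ℂ) ∈ e.source := hc.mem_toOpenPartialHomeomorph_source hd2 one_ne_zero
  have hinv : ContDiffAt ℂ 1 e.symm 0 := by
    have := hc.to_localInverse hd2 one_ne_zero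
    rw [hz] at this
    exact this
  have hev : ∀ᶠ q in nhds (0 : ℂ × ℂ), DifferentiableAt ℂ e.symm q := by
    filter_upwards [hinv.eventually (by simp)] with q hq
    exact hq.differentiableAt one_ne_zero
  obtain ⟨W0, hW0, hW0o, hW00⟩ := eventually_nhds_iff.1 hev
  have hVo : IsOpen ((e.source ∩ e ⁻¹' W0) ∩ B) := (e.isOpen_inter_preimage hW0o).inter hB
  have hVs : (e.source ∩ e ⁻¹' W0) ∩ B ⊆ e.source := fun x hx => hx.1.1
  have h0V : (0 : ℂ × ℂ) ∈ (e.source ∩ e ⁻¹' W0) ∩ B :=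
    ⟨⟨hs, by rw [Set.mem_preimage, hcoe, hz]; exact hW00⟩, hB0⟩
  refine ⟨(e.source ∩ e ⁻¹' W0) ∩ B, e '' ((e.source ∩ e ⁻¹' W0) ∩ B), e.symm, hVo,
    e.isOpen_image_of_subset_source hVo hVs, h0V, ⟨0, h0V, hz⟩, fun x hx => hx.2, ?_, ?_, ?_, ?_⟩
  · rintro _ ⟨p, hp, rfl⟩
    exact (hW0 _ hp.1.2).differentiableWithinAt
  · exact (e.injOn.mono hVs).bijOn_image
  · intro p hp
    exact e.left_inv (hVs hp)
  · rintro _ ⟨p, hp, rfl⟩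
    have := e.left_inv (hVs hp)
    rw [this]; rfl

theorem scaled_hasFDerivAt {g : Idx → ℂ} {M : ℝ} (hg : ∀ n, ‖g n‖ ≤ M) {t : ℂ} {p : ℂ × ℂ}
    (hp : ‖t • p‖ < 1/2) :
    HasFDerivAt (fun p : ℂ × ℂ => Ser g (t * p.1) (t * p.2)) (t • DSer g (t • p)) p := by
  have h1 : HasFDerivAt (fun p : ℂ × ℂ => t • p) (t • ContinuousLinearMap.id ℂ (ℂ × ℂ)) p :=
    (hasFDerivAt_id p).const_smul t
  have h2 := (ser_hasFDerivAt hg hp).comp p h1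
  have h3 : (DSer g (t • p)).comp (t • ContinuousLinearMap.id ℂ (ℂ × ℂ)) = t • DSer g (t • p) := by
    ext <;> simp
  rw [h3] at h2
  exact h2

theorem scaled_contDiffAt {g : Idx → ℂ} {M : ℝ} (hg : ∀ n, ‖g n‖ ≤ M) (t : ℂ) :
    ContDiffAt ℂ 1 (fun p : ℂ × ℂ => Ser g (t * p.1) (t * p.2)) 0 := by
  have h1 : ContDiffAt ℂ 1 (fun p : ℂ × ℂ => t • p) 0 := contDiffAt_id.const_smul t
  have h2 : ContDiffAt ℂ 1 (fun w : ℂ × ℂ => Ser g w.1 w.2) (t • (0 : ℂ × ℂ)) := by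
    rw [smul_zero]; exact ser_contDiffAt hg
  exact h2.comp (0 : ℂ × ℂ) h1

/-- Taylor data of the vector field after scaling to the unit bidisc. -/
theorem taylor_data {lam₁ : ℂ}
    {U : Set (ℂ × ℂ)} (hU : IsOpen U) (h0 : ((0 : ℂ), (0 : ℂ)) ∈ U)
    {f₁ h : ℂ × ℂ → ℂ}
    (hf₁ : DifferentiableOn ℂ f₁ U) (hh : DifferentiableOn ℂ h U)
    (hf₁0 : f₁ (0, 0) = lam₁)
    (hh0 : h (0, 0) = 0) (hDh : fderiv ℂ h (0, 0) = 0) :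
    ∃ (r : ℝ) (k hc : Idx → ℂ) (M : ℝ), 0 < r ∧ (∀ n, ‖k n‖ ≤ M) ∧ (∀ n, dg n ≤ 0 → k n = 0) ∧
      (∀ n, ‖hc n‖ ≤ M) ∧ (∀ n, dg n ≤ 1 → hc n = 0) ∧
      ∀ x y : ℂ, ‖x‖ < 1 → ‖y‖ < 1 → f₁ (r * x, r * y) = lam₁ + Ser k x y ∧
        h (r * x, r * y) = r * Ser hc x y := by
  obtain ⟨r, hr0, hr⟩ := Metric.nhds_basis_closedBall.mem_iff.1 (hU.mem_nhds h0)
  have hrC : (r : ℂ) ≠ 0 := by exact_mod_cast hr0.ne'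
  have hmaps : Set.MapsTo (fun p : ℂ × ℂ => (((r : ℂ) * p.1, (r : ℂ) * p.2) : ℂ × ℂ))
      (Metric.closedBall 0 1) U := by
    intro p hp
    apply hr
    have hz : (((0 : ℂ), (0 : ℂ)) : ℂ × ℂ) = 0 := rfl
    rw [hz, mem_closedBall_zero_iff]
    rw [mem_closedBall_zero_iff] at hp
    have h1 : (((r : ℂ) * p.1, (r : ℂ) * p.2) : ℂ × ℂ) = (r : ℂ) • p := rfl
    change ‖(((r : ℂ) * p.1, (r : ℂ) * p.2) : ℂ × ℂ)‖ ≤ r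
    rw [h1, norm_smul, Complex.norm_real, Real.norm_of_nonneg hr0.le]
    nlinarith
  have hsc : DifferentiableOn ℂ (fun p : ℂ × ℂ => (((r : ℂ) * p.1, (r : ℂ) * p.2) : ℂ × ℂ))
      (Metric.closedBall 0 1) := by fun_prop
  have hF1 : DifferentiableOn ℂ (fun p : ℂ × ℂ => f₁ ((r : ℂ) * p.1, (r : ℂ) * p.2) - lam₁)
      (Metric.closedBall 0 1) := (hf₁.comp hsc hmaps).sub_const lam₁
  have hF2 : DifferentiableOn ℂ (fun p : ℂ × ℂ => (r : ℂ)⁻¹ * h ((r : ℂ) * p.1, (r : ℂ) * p.2))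
      (Metric.closedBall 0 1) := (hh.comp hsc hmaps).const_mul _
  obtain ⟨k, M1, hk, hkS⟩ := taylor2 hF1
  obtain ⟨hc, M2, hhc, hcS⟩ := taylor2 hF2
  have hc0 : hc 0 = 0 := by
    have := hcS 0 0 (by simp) (by simp)
    rw [ser_zero] at this
    simpa [hh0] using this.symm
  have hder : ∀ v : ℂ × ℂ, DSer hc 0 v = 0 := by
    have hd1 : HasFDerivAt h (0 : ℂ × ℂ →L[ℂ] ℂ) (0, 0) := by
      have := (hh.differentiableAt (hU.mem_nhds h0)).hasFDerivAt
      rwa [hDh] at this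
    have hd2 : HasFDerivAt (fun p : ℂ × ℂ => (r : ℂ) • p) ((r : ℂ) • ContinuousLinearMap.id ℂ (ℂ × ℂ)) 0 :=
      (hasFDerivAt_id (0 : ℂ × ℂ)).const_smul (r : ℂ)
    have hd3 : HasFDerivAt h (0 : ℂ × ℂ →L[ℂ] ℂ) ((r : ℂ) • (0 : ℂ × ℂ)) := by
      rw [smul_zero]; exact hd1
    have hd4 := (hd3.comp (0 : ℂ × ℂ) hd2).const_smul ((r : ℂ)⁻¹)
    have hd5 : HasFDerivAt (fun w : ℂ × ℂ => Ser hc w.1 w.2) (DSer hc 0) 0 :=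
      ser_hasFDerivAt hhc (by simp)
    have hee : (fun w : ℂ × ℂ => Ser hc w.1 w.2) =ᶠ[nhds 0]
        (fun p : ℂ × ℂ => (r : ℂ)⁻¹ • (h ∘ fun p : ℂ × ℂ => (r : ℂ) • p) p) := by
      filter_upwards [Metric.ball_mem_nhds (0 : ℂ × ℂ) one_pos] with w hw
      rw [mem_ball_zero_iff] at hw
      exact (hcS w.1 w.2 ((norm_fst_le w).trans_lt hw) ((norm_snd_le w).trans_lt hw)).symm
    have hd6 := hd4.congr_of_eventuallyEq hee
    intro v
    rw [hd5.unique hd6]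
    simp
  refine ⟨r, k, hc, max M1 M2, hr0, fun n => (hk n).trans (le_max_left _ _), ?_,
    fun n => (hhc n).trans (le_max_right _ _), ?_, ?_⟩
  · intro n hn
    rw [dg_eq_zero (Nat.le_zero.1 hn)]
    have := hkS 0 0 (by simp) (by simp)
    rw [ser_zero] at this
    simpa [hf₁0] using this.symm
  · intro n hn
    have hE0 := hder (1, 0)
    have hE1 := hder (0, 1)
    rw [dser_zero hhc] at hE0 hE1
    simp only [mul_one, mul_zero, add_zero, zero_add] at hE0 hE1
    have hcase : n = 0 ∨ n = e0 ∨ n = e1 := by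
      unfold dg at hn
      rcases Nat.eq_zero_or_pos (n 0) with h1 | h1
      · rcases Nat.eq_zero_or_pos (n 1) with h2 | h2
        · left; exact idx_ext (by simpa using h1) (by simpa using h2)
        · right; right; exact idx_ext (by simp [e1]; omega) (by simp [e1]; omega)
      · right; left; exact idx_ext (by simp [e0]; omega) (by simp [e0]; omega)
    rcases hcase with h1 | h1 | h1 <;> rw [h1] <;> assumption
  · intro x y hx hy
    have h1 := hkS x y hx hy
    have h2 := hcS x y hx hy
    simp only at h1 h2
    refine ⟨?_, ?_⟩
    · rw [← h1]; ring
    · rw [← h2, mul_inv_cancel_left₀ hrC]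

theorem main_result
    (lam₁ lam₂ : ℂ) (hlam₁ : lam₁ ≠ 0) (hlam₂ : lam₂ ≠ 0)
    (hP : PoincareDomain lam₁ lam₂) (hNR : ¬ Resonant lam₁ lam₂)
    (U : Set (ℂ × ℂ)) (hU : IsOpen U) (h0 : (0, 0) ∈ U)
    (f₁ h : ℂ × ℂ → ℂ)
    (hf₁ : DifferentiableOn ℂ f₁ U) (hh : DifferentiableOn ℂ h U)
    (hf₁0 : f₁ (0, 0) = lam₁)
    (hh0 : h (0, 0) = 0) (hDh : fderiv ℂ h (0, 0) = 0)
    (F : ℂ × ℂ → ℂ × ℂ)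
    (hF : ∀ p : ℂ × ℂ, F p = (p.1 * f₁ p, lam₂ * p.2 + h p)) :
    ∃ (V W : Set (ℂ × ℂ)) (Ψ Φ : ℂ × ℂ → ℂ × ℂ),
      IsOpen V ∧ IsOpen W ∧ (0, 0) ∈ V ∧ (0, 0) ∈ W ∧
      DifferentiableOn ℂ Ψ V ∧ DifferentiableOn ℂ Φ W ∧
      Set.BijOn Ψ V W ∧ (∀ p ∈ V, Φ (Ψ p) = p) ∧ (∀ q ∈ W, Ψ (Φ q) = q) ∧
      Ψ (0, 0) = (0, 0) ∧ fderiv ℂ Ψ (0, 0) = ContinuousLinearMap.id ℂ (ℂ × ℂ) ∧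
      (∀ p ∈ V, fderiv ℂ Ψ p (lam₁ * p.1, lam₂ * p.2) = F (Ψ p)) ∧
      (∀ zt : ℂ, ((0 : ℂ), zt) ∈ V → (Ψ (0, zt)).1 = 0) ∧
      (∃ c : ℂ × ℂ → ℂ, DifferentiableOn ℂ c V ∧ c (0, 0) = 1 ∧
        ∀ p ∈ V, (Ψ p).1 = p.1 * c p) := by
  obtain ⟨r, k, hc, M, hr0, hk, hk0, hhc, hhc0, hT⟩ := taylor_data hU h0 hf₁ hh hf₁0 hh0 hDh
  obtain ⟨s, hs0, a, b, N, ha, hb, ha0, hb0, hsol⟩ := exists_solution hP hNR hk hk0 hhc hhc0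
  have hrC : (r : ℂ) ≠ 0 := by exact_mod_cast hr0.ne'
  have hsC : (s : ℂ) ≠ 0 := by exact_mod_cast hs0.ne'
  have hb00 : b 0 = 0 := hb0 0 (by simp [dg])
  have hbe0 : b e0 = 0 := hb0 e0 (by simp [dg, e0])
  have hbe1 : b e1 = 0 := hb0 e1 (by simp [dg, e1])
  obtain ⟨t, ht⟩ : ∃ t : ℂ, t = ((r : ℂ) * s)⁻¹ := ⟨_, rfl⟩
  have ht1 : (r : ℂ) * s * t = 1 := by rw [ht]; exact mul_inv_cancel₀ (mul_ne_zero hrC hsC)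
  set c : ℂ × ℂ → ℂ := fun p => 1 + Ser a (t * p.1) (t * p.2) with hcdef
  set Ψ : ℂ × ℂ → ℂ × ℂ := fun p =>
    (p.1 * (1 + Ser a (t * p.1) (t * p.2)), p.2 + (r * s) * Ser b (t * p.1) (t * p.2)) with hΨ
  have hΨd : ∀ p : ℂ × ℂ, ‖t • p‖ < 1/2 → HasFDerivAt Ψ
      ((p.1 • (t • DSer a (t • p)) +
          (1 + Ser a (t * p.1) (t * p.2)) • ContinuousLinearMap.fst ℂ ℂ ℂ).prod
        (ContinuousLinearMap.snd ℂ ℂ ℂ + ((r : ℂ) * s) • (t • DSer b (t • p)))) p := by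
    intro p hp
    exact (hasFDerivAt_fst.mul ((scaled_hasFDerivAt ha hp).const_add 1)).prodMk
      (hasFDerivAt_snd.add ((scaled_hasFDerivAt hb hp).const_mul _))
  have hSa : Ser a (0 : ℂ) 0 = 0 := by rw [ser_zero, ha0, zero_smul]
  have hSb : Ser b (0 : ℂ) 0 = 0 := by rw [ser_zero, hb00, zero_smul]
  have hΨid : HasFDerivAt Ψ (ContinuousLinearMap.id ℂ (ℂ × ℂ)) 0 := by
    have h1 := hΨd 0 (by simp)
    have h2 : ((0 : ℂ × ℂ).1 • (t • DSer a (t • (0 : ℂ × ℂ))) +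
          (1 + Ser a (t * (0 : ℂ × ℂ).1) (t * (0 : ℂ × ℂ).2)) • ContinuousLinearMap.fst ℂ ℂ ℂ).prod
        (ContinuousLinearMap.snd ℂ ℂ ℂ + ((r : ℂ) * s) • (t • DSer b (t • (0 : ℂ × ℂ)))) =
        ContinuousLinearMap.id ℂ (ℂ × ℂ) := by
      apply ContinuousLinearMap.ext
      intro v
      have h3 : DSer b 0 v = 0 := by
        rw [dser_zero hb, hbe0, hbe1]; simp
      refine Prod.ext ?_ ?_
      · change (0 : ℂ) * (t * DSer a (t • (0 : ℂ × ℂ)) v) + (1 + Ser a (t * 0) (t * 0)) * v.1 = v.1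
        rw [mul_zero, hSa]; ring
      · change v.2 + ((r : ℂ) * s) * (t * DSer b (t • (0 : ℂ × ℂ)) v) = v.2
        rw [smul_zero, h3]; ring
    rwa [h2] at h1
  have hΨ0 : Ψ 0 = 0 := by
    simp only [hΨ, Prod.fst_zero, Prod.snd_zero, mul_zero, hSb, zero_mul, add_zero]
    rfl
  have hΨc : ContDiffAt ℂ 1 Ψ 0 :=
    (contDiffAt_fst.mul (contDiffAt_const.add (scaled_contDiffAt ha t))).prodMk
      (contDiffAt_snd.add (contDiffAt_const.mul (scaled_contDiffAt hb t)))
  have hBo : IsOpen {p : ℂ × ℂ | ‖t • p‖ < 1/2} :=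
    isOpen_lt (by fun_prop) continuous_const
  obtain ⟨V, W, Φ, hVo, hWo, hV0, hW0, hVB, hΦ, hbij, hl, hr⟩ :=
    bihol hΨc hΨid hΨ0 hBo (by simp)
  refine ⟨V, W, Ψ, Φ, hVo, hWo, hV0, hW0,
    fun p hp => (hΨd p (hVB hp)).differentiableAt.differentiableWithinAt, hΦ, hbij, hl, hr,
    hΨ0, hΨid.fderiv, ?_, ?_, c, ?_, ?_, ?_⟩
  · intro p hp
    rw [(hΨd p (hVB hp)).fderiv, hF]
    obtain ⟨hx, hy, e1, e2⟩ := hsol (t • p) (hVB hp)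
    simp only [Prod.smul_fst, Prod.smul_snd, smul_eq_mul] at hx hy e1 e2
    obtain ⟨g1, g2⟩ := hT _ _ hx hy
    have hP1 : (r : ℂ) * (s * (t * p.1 * (1 + Ser a (t * p.1) (t * p.2)))) = (Ψ p).1 := by
      simp only [hΨ]
      linear_combination (p.1 * (1 + Ser a (t * p.1) (t * p.2))) * ht1
    have hP2 : (r : ℂ) * (s * (t * p.2 + Ser b (t * p.1) (t * p.2))) = (Ψ p).2 := by
      simp only [hΨ]
      linear_combination p.2 * ht1
    rw [hP1, hP2] at g1
    rw [hP1, hP2, ← e2] at g2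
    have hv : ((lam₁ * (t * p.1), lam₂ * (t * p.2)) : ℂ × ℂ) = t • ((lam₁ * p.1, lam₂ * p.2) : ℂ × ℂ) := by
      rw [Prod.smul_mk, smul_eq_mul, smul_eq_mul]
      exact Prod.ext (by ring) (by ring)
    rw [hv, map_smul, smul_eq_mul] at e1
    rw [hv, map_smul, smul_eq_mul] at g2
    change f₁ (Ψ p) = _ at g1
    change h (Ψ p) = _ at g2
    rw [g1, g2]
    refine Prod.ext ?_ ?_
    · change p.1 * (t * DSer a (t • p) (lam₁ * p.1, lam₂ * p.2)) +
        (1 + Ser a (t * p.1) (t * p.2)) * (lam₁ * p.1) = (p.1 * (1 + Ser a (t * p.1) (t * p.2))) * _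
      rw [e1]; ring
    · change lam₂ * p.2 + ((r : ℂ) * s) * (t * DSer b (t • p) (lam₁ * p.1, lam₂ * p.2)) =
        lam₂ * (p.2 + (r * s) * Ser b (t * p.1) (t * p.2)) + _
      ring
  · intro zt _
    simp [hΨ]
  · intro p hp
    exact ((scaled_hasFDerivAt ha (hVB hp)).const_add 1).differentiableAt.differentiableWithinAt
  · simp [hcdef, hSa]
  · intro p _
    rfl

end PLin

/-- for a vector field whose first component is divisible by `u`
(invariant plane `{u = 0}`), with nonresonant Poincaré spectrum, the Poincaré
linearizing biholomorphism `Ψ` can be chosen with first component divisible by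
the first coordinate. -/
theorem poincare_linearization_factorization
    (lam₁ lam₂ : ℂ) (hlam₁ : lam₁ ≠ 0) (hlam₂ : lam₂ ≠ 0)
    (hP : PoincareDomain lam₁ lam₂) (hNR : ¬ Resonant lam₁ lam₂)
    (U : Set (ℂ × ℂ)) (hU : IsOpen U) (h0 : (0, 0) ∈ U)
    (f₁ h : ℂ × ℂ → ℂ)
    (hf₁ : DifferentiableOn ℂ f₁ U) (hh : DifferentiableOn ℂ h U)
    (hf₁0 : f₁ (0, 0) = lam₁)
    (hh0 : h (0, 0) = 0) (hDh : fderiv ℂ h (0, 0) = 0)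
    (F : ℂ × ℂ → ℂ × ℂ)
    (hF : ∀ p : ℂ × ℂ, F p = (p.1 * f₁ p, lam₂ * p.2 + h p)) :
    ∃ (V W : Set (ℂ × ℂ)) (Ψ Φ : ℂ × ℂ → ℂ × ℂ),
      IsOpen V ∧ IsOpen W ∧ (0, 0) ∈ V ∧ (0, 0) ∈ W ∧
      DifferentiableOn ℂ Ψ V ∧ DifferentiableOn ℂ Φ W ∧
      Set.BijOn Ψ V W ∧ (∀ p ∈ V, Φ (Ψ p) = p) ∧ (∀ q ∈ W, Ψ (Φ q) = q) ∧
      Ψ (0, 0) = (0, 0) ∧ fderiv ℂ Ψ (0, 0) = ContinuousLinearMap.id ℂ (ℂ × ℂ) ∧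
      (∀ p ∈ V, fderiv ℂ Ψ p (lam₁ * p.1, lam₂ * p.2) = F (Ψ p)) ∧
      (∀ zt : ℂ, ((0 : ℂ), zt) ∈ V → (Ψ (0, zt)).1 = 0) ∧
      (∃ c : ℂ × ℂ → ℂ, DifferentiableOn ℂ c V ∧ c (0, 0) = 1 ∧
        ∀ p ∈ V, (Ψ p).1 = p.1 * c p) := by
  exact PLin.main_result lam₁ lam₂ hlam₁ hlam₂ hP hNR U hU h0 f₁ h hf₁ hh hf₁0 hh0 hDh F hF
end

section
/- Let b₁ > 0 and b₃ be real, set β := b₃/b₁ and d := 1 + b₁²(1−β), and consider the planar vector field F(v,w) = ( −v·((3b₁+b₃)/4 − v + b₁w²), w·((b₁−b₃)/4 + v + w − b₁w²) ) (the blow-up chart v = 1/y, w = x/y of the asymmetric Galerkin caricature with b₂ = −2). Then: (a) both coordinate axes are invariant, (0,0) is an equilibrium, and the Jacobian there is diagonal with eigenvalues b₁λ₁ = −(β+3)b₁/4 and b₁λ₂ = −(β−1)b₁/4, so the spectral quotient is λ = (β+3)/(β−1) whenever β ≠ 1; (b) the equilibria at infinity with v = 0 and w = e ≠ 0 are exactly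 the roots e = e_± = (1 ± √d)/(2b₁) of b₁w² − w + (b₃−b₁)/4 = 0, and at each such (0, e) the Jacobian is lower triangular with eigenvalues λ₁ = −e − b₁ and λ₂ = −e − b₁(1−β)/2; (c) for d < 0, i.e. β > 1 + 1/b₁², the equilibria e_± and both eigenvalues are nonreal complex conjugate, so the spectral pair lies in the Poincaré domain and is automatically nonresonant. -/
lemma chart_fderiv (A B b : ℂ) (F : ℂ × ℂ → ℂ × ℂ)
    (hF : ∀ p : ℂ × ℂ, F p = (-(p.1) * (A - p.1 + b * p.2 ^ 2),
      p.2 * (B + p.1 + p.2 - b * p.2 ^ 2))) (e : ℂ) (p : ℂ × ℂ) :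
    fderiv ℂ F (0, e) p =
      (-(A + b * e ^ 2) * p.1, e * p.1 + (B + 2 * e - 3 * b * e ^ 2) * p.2) := by
  obtain rfl : F = fun p => (-(p.1) * (A - p.1 + b * p.2 ^ 2),
      p.2 * (B + p.1 + p.2 - b * p.2 ^ 2)) := funext hF
  have h1 : HasFDerivAt (fun p : ℂ × ℂ => p.1) (ContinuousLinearMap.fst ℂ ℂ ℂ) (0, e) :=
    hasFDerivAt_fst
  have h2 : HasFDerivAt (fun p : ℂ × ℂ => p.2) (ContinuousLinearMap.snd ℂ ℂ ℂ) (0, e) :=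
    hasFDerivAt_snd
  have hq := (h2.pow 2).const_mul b
  have hA := h1.fun_neg.fun_mul ((h1.const_sub A).fun_add hq)
  have hB := h2.fun_mul (((h1.const_add B).fun_add h2).fun_sub hq)
  rw [(hA.prodMk hB).fderiv]
  ext
  · simp
    ring
  · simp
    ring

lemma poincare_of_im (l₁ l₂ : ℂ) (h : l₁.im = l₂.im) (h0 : l₁.im ≠ 0) :
    PoincareDomain l₁ l₂ := by
  rintro ⟨a, b, _, _, hab, h'⟩
  have := congrArg Complex.im h'
  simp only [Complex.add_im, Complex.real_smul, Complex.re_ofReal_mul, Complex.im_ofReal_mul,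
    Complex.zero_im, ← h] at this
  apply h0
  linear_combination this - l₁.im * hab

lemma not_resonant_of_im (l₁ l₂ : ℂ) (h : l₁.im = l₂.im) (h0 : l₁.im ≠ 0) :
    ¬ Resonant l₁ l₂ := by
  rintro ⟨m, n, hmn, h'⟩
  have key : l₁.im = m * l₁.im + n * l₁.im := by
    rcases h' with h' | h'
    · have := congrArg Complex.im h'
      simpa [← h] using this
    · have := congrArg Complex.im h'
      simpa [← h] using this
  have h2 : (2 : ℝ) ≤ m + n := by exact_mod_cast hmn
  have : ((m : ℝ) + n - 1) * l₁.im = 0 := by linear_combination -key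
  rcases mul_eq_zero.mp this with h3 | h3
  · linarith
  · exact h0 h3

/-- the blow-up chart `v = 1/y, w = x/y` of the asymmetric
Galerkin caricature (`b₂ = −2`): invariant axes, spectra of the trivial and the
nontrivial blow-up equilibria, and the nonreal conjugate (hence nonresonant
Poincaré) case of negative discriminant `d < 0`. -/
theorem asymmetric_galerkin_blowup_chart
    (b₁ b₃ β d : ℝ) (hb₁ : 0 < b₁)
    (hβ : β = b₃ / b₁) (hd : d = 1 + b₁ ^ 2 * (1 - β))
    (F : ℂ × ℂ → ℂ × ℂ)
    (hF : ∀ p : ℂ × ℂ,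
      F p = (-(p.1) * ((3 * (b₁ : ℂ) + (b₃ : ℂ)) / 4 - p.1 + (b₁ : ℂ) * p.2 ^ 2),
             p.2 * (((b₁ : ℂ) - (b₃ : ℂ)) / 4 + p.1 + p.2 - (b₁ : ℂ) * p.2 ^ 2))) :
    -- (a) invariant axes, trivial equilibrium, diagonal Jacobian
    (∀ w : ℂ, (F (0, w)).1 = 0) ∧
    (∀ v : ℂ, (F (v, 0)).2 = 0) ∧
    F (0, 0) = (0, 0) ∧
    (∀ p : ℂ × ℂ, fderiv ℂ F (0, 0) p =
      (-((3 * (b₁ : ℂ) + (b₃ : ℂ)) / 4) * p.1, (((b₁ : ℂ) - (b₃ : ℂ)) / 4) * p.2)) ∧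
    (-(3 * b₁ + b₃) / 4 = -(β + 3) * b₁ / 4) ∧
    ((b₁ - b₃) / 4 = -(β - 1) * b₁ / 4) ∧
    (β ≠ 1 → (-(β + 3) * b₁ / 4) / (-(β - 1) * b₁ / 4) = (β + 3) / (β - 1)) ∧
    -- (b) nontrivial equilibria at infinity and their (lower triangular) spectra
    (∀ e : ℂ, e ≠ 0 →
      (F (0, e) = (0, 0) ↔ (b₁ : ℂ) * e ^ 2 - e + ((b₃ : ℂ) - (b₁ : ℂ)) / 4 = 0)) ∧
    (∀ sq : ℂ, sq ^ 2 = (d : ℂ) →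
      ∀ e : ℂ, ((b₁ : ℂ) * e ^ 2 - e + ((b₃ : ℂ) - (b₁ : ℂ)) / 4 = 0 ↔
        (e = (1 + sq) / (2 * (b₁ : ℂ)) ∨ e = (1 - sq) / (2 * (b₁ : ℂ))))) ∧
    (∀ e : ℂ, (b₁ : ℂ) * e ^ 2 - e + ((b₃ : ℂ) - (b₁ : ℂ)) / 4 = 0 →
      ∃ c : ℂ, ∀ p : ℂ × ℂ, fderiv ℂ F (0, e) p =
        ((-e - (b₁ : ℂ)) * p.1,
          c * p.1 + (-e - (b₁ : ℂ) * (1 - (β : ℂ)) / 2) * p.2)) ∧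
    -- (c) negative discriminant: nonreal conjugate equilibria and spectra,
    --     automatically nonresonant Poincaré
    ((d < 0 ↔ 1 + 1 / b₁ ^ 2 < β) ∧
     (d < 0 →
      (Complex.I * (Real.sqrt (-d) : ℂ)) ^ 2 = (d : ℂ) ∧
      (1 - Complex.I * (Real.sqrt (-d) : ℂ)) / (2 * (b₁ : ℂ)) =
        (starRingEnd ℂ) ((1 + Complex.I * (Real.sqrt (-d) : ℂ)) / (2 * (b₁ : ℂ))) ∧
      ∀ e ∈ ({(1 + Complex.I * (Real.sqrt (-d) : ℂ)) / (2 * (b₁ : ℂ)),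
              (1 - Complex.I * (Real.sqrt (-d) : ℂ)) / (2 * (b₁ : ℂ))} : Set ℂ),
        (b₁ : ℂ) * e ^ 2 - e + ((b₃ : ℂ) - (b₁ : ℂ)) / 4 = 0 ∧
        e.im ≠ 0 ∧
        (-e - (b₁ : ℂ)).im ≠ 0 ∧ (-e - (b₁ : ℂ) * (1 - (β : ℂ)) / 2).im ≠ 0 ∧
        PoincareDomain (-e - (b₁ : ℂ)) (-e - (b₁ : ℂ) * (1 - (β : ℂ)) / 2) ∧
        ¬ Resonant (-e - (b₁ : ℂ)) (-e - (b₁ : ℂ) * (1 - (β : ℂ)) / 2))) := by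
  have hb : b₁ ≠ 0 := hb₁.ne'
  have hbc : (b₁ : ℂ) ≠ 0 := by exact_mod_cast hb
  have hb3 : b₃ = β * b₁ := by rw [hβ]; field_simp
  have hb3c : (b₃ : ℂ) = β * b₁ := by rw [hb3]; push_cast; ring
  have hdc : (d : ℂ) = 1 + (b₁ : ℂ) ^ 2 * (1 - β) := by rw [hd]; push_cast; ring
  have hJ := chart_fderiv _ _ _ F hF
  have hroots : ∀ sq : ℂ, sq ^ 2 = (d : ℂ) →
      ∀ e : ℂ, ((b₁ : ℂ) * e ^ 2 - e + ((b₃ : ℂ) - (b₁ : ℂ)) / 4 = 0 ↔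
        (e = (1 + sq) / (2 * (b₁ : ℂ)) ∨ e = (1 - sq) / (2 * (b₁ : ℂ)))) := by
    intro sq hsq e
    have h2 : (2 * (b₁ : ℂ)) ≠ 0 := mul_ne_zero two_ne_zero hbc
    have hfac : 4 * (b₁ : ℂ) * ((b₁ : ℂ) * e ^ 2 - e + ((b₃ : ℂ) - (b₁ : ℂ)) / 4) =
        (e * (2 * b₁) - (1 + sq)) * (e * (2 * b₁) - (1 - sq)) := by
      rw [hb3c]
      linear_combination hsq + hdc
    rw [eq_div_iff h2, eq_div_iff h2, ← sub_eq_zero (b := 1 + sq), ← sub_eq_zero (b := 1 - sq),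
      ← mul_eq_zero, ← hfac]
    simp [hbc]
  refine ⟨?_, ?_, ?_, ?_, ?_, ?_, ?_, ?_, hroots, ?_, ?_, ?_⟩
  · intro w; simp [hF]
  · intro v; simp [hF]
  · simp [hF]
  · intro p; rw [hJ]; simp
  · rw [hb3]; ring
  · rw [hb3]; ring
  · intro h
    have : β - 1 ≠ 0 := sub_ne_zero.mpr h
    field_simp
  · intro e he
    rw [hF, Prod.mk.injEq]
    constructor
    · rintro ⟨-, h⟩
      rcases mul_eq_zero.mp h with h | h
      · exact absurd h he
      · simp only at h
        linear_combination -h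
    · intro h
      refine ⟨by simp, ?_⟩
      simp only
      linear_combination -e * h
  · intro e he
    refine ⟨e, fun p => ?_⟩
    rw [hJ]
    ext
    · simp only
      linear_combination -p.1 * he
    · simp only
      rw [hb3c] at he ⊢
      linear_combination -3 * p.2 * he
  · rw [hd]
    have hp : 0 < b₁ ^ 2 := by positivity
    have hiff : 1 + 1 / b₁ ^ 2 < β ↔ 1 < (β - 1) * b₁ ^ 2 := by
      rw [← div_lt_iff₀ hp]
      constructor <;> intro h <;> linarith
    rw [hiff]
    constructor <;> intro h <;> nlinarith
  · intro hneg
    have hs : 0 < Real.sqrt (-d) := Real.sqrt_pos.mpr (by linarith)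
    have hsq : (Complex.I * (Real.sqrt (-d) : ℂ)) ^ 2 = (d : ℂ) := by
      rw [mul_pow, Complex.I_sq, ← Complex.ofReal_pow, Real.sq_sqrt (by linarith)]
      push_cast; ring
    refine ⟨hsq, ?_, ?_⟩
    · have h2 : (starRingEnd ℂ) 2 = 2 := Complex.conj_ofNat 2
      simp [sub_eq_add_neg, h2]
    · intro e he
      have hroot := (hroots _ hsq e).mpr he
      have him : e.im ≠ 0 := by
        have hcast : (2 * (b₁ : ℂ)) = ((2 * b₁ : ℝ) : ℂ) := by push_cast; rfl
        rcases he with he | he <;> rw [he, hcast, Complex.div_ofReal_im] <;>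
          simp [hb, hs.ne']
      have e1 : (-e - (b₁ : ℂ)).im = -e.im := by simp
      have e2 : (-e - (b₁ : ℂ) * (1 - (β : ℂ)) / 2).im = -e.im := by
        have : (b₁ : ℂ) * (1 - (β : ℂ)) / 2 = ((b₁ * (1 - β) / 2 : ℝ) : ℂ) := by push_cast; rfl
        rw [this]; simp
      have n1 : (-e - (b₁ : ℂ)).im ≠ 0 := by rw [e1]; exact neg_ne_zero.mpr him
      exact ⟨hroot, him, n1, by rw [e2]; exact neg_ne_zero.mpr him,
        poincare_of_im _ _ (e1.trans e2.symm) n1, not_resonant_of_im _ _ (e1.trans e2.symm) n1⟩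
end

section
/- Let a ∈ ℂ \ {0, 1} and consider the blow-up system of the symmetric Galerkin caricature, F(u,z) = ( −u·(1 + a·z²/4), z·(a − 1 − u − a·z²/4) ). Then: (a) (0,0) is an equilibrium, the axes {z = 0} and {u = 0} are invariant, the Jacobian at (0,0) is diagonal with semisimple eigenvalues λ₁ = −1 and λ₂ = a − 1, and the spectral quotient is λ = 1/(1−a); (b) the equilibria with u = 0 and z = e ≠ 0 are exactly the points with e² = 4(1 − 1/a), i.e. e = e_± = ±2√(1 − 1/a), and at each such (0,e) the Jacobian is lower triangular (its upper-right entry vanishes) with eigenvalues λ₁ = −a and λ₂ = 2(1 − a), hence spectral quotient λ = (1/2)·a/(a−1); in particular, for the original Fujita case a = 2 the eigenvalues λ₁ = λ₂ = −2 coincide but are NOT semisimple, since the lower-left Jacobian entry −e_± is nonzero. -/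
theorem galerkin_fderiv (a : ℂ) (F : ℂ × ℂ → ℂ × ℂ)
    (hF : ∀ p : ℂ × ℂ,
      F p = (-(p.1) * (1 + a * p.2 ^ 2 / 4),
             p.2 * (a - 1 - p.1 - a * p.2 ^ 2 / 4))) (q p : ℂ × ℂ) :
    fderiv ℂ F q p =
      (-(1 + a * q.2 ^ 2 / 4) * p.1 - q.1 * (a * q.2 / 2) * p.2,
       -q.2 * p.1 + (a - 1 - q.1 - 3 * a * q.2 ^ 2 / 4) * p.2) := by
  have h1 : HasFDerivAt (fun x : ℂ × ℂ => x.1) (ContinuousLinearMap.fst ℂ ℂ ℂ) q :=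
    hasFDerivAt_fst
  have h2 : HasFDerivAt (fun x : ℂ × ℂ => x.2) (ContinuousLinearMap.snd ℂ ℂ ℂ) q :=
    hasFDerivAt_snd
  have hw := ((h2.mul h2).const_mul (a / 4))
  have hA := h1.neg.mul (hw.const_add 1)
  have hB := h2.mul ((h1.const_sub (a - 1)).sub hw)
  have hAB := hA.prodMk hB
  have hFe : F = fun x : ℂ × ℂ => (-x.1 * (1 + a / 4 * (x.2 * x.2)),
      x.2 * (a - 1 - x.1 - a / 4 * (x.2 * x.2))) := by
    funext x
    rw [hF]
    ext <;> simp only [] <;> ring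
  rw [hFe]
  refine (congrArg (fun L : ℂ × ℂ →L[ℂ] ℂ × ℂ => L p) (HasFDerivAt.fderiv hAB)).trans ?_
  ext
  · simp
    ring
  · simp
    ring

/-- the blow-up chart `u = 1/x, z = y/x` of the symmetric
Galerkin caricature `du/dt₁ = −u(1+az²/4)`, `dz/dt₁ = z(a−1−u−az²/4)`:
invariant axes, diagonal spectrum at the trivial blow-up equilibrium `(0,0)`,
nontrivial blow-up equilibria `e_± = ±2√(1−1/a)` with lower triangular
Jacobian and eigenvalues `λ₁ = −a`, `λ₂ = 2(1−a)`; in the original Fujita case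
`a = 2` the double eigenvalue `−2` is NOT semisimple. -/
theorem symmetric_galerkin_blowup_chart
    (a : ℂ) (ha0 : a ≠ 0) (ha1 : a ≠ 1)
    (F : ℂ × ℂ → ℂ × ℂ)
    (hF : ∀ p : ℂ × ℂ,
      F p = (-(p.1) * (1 + a * p.2 ^ 2 / 4),
             p.2 * (a - 1 - p.1 - a * p.2 ^ 2 / 4))) :
    -- (a) trivial equilibrium, invariant axes, semisimple diagonal Jacobian
    F (0, 0) = (0, 0) ∧
    (∀ u : ℂ, (F (u, 0)).2 = 0) ∧
    (∀ z : ℂ, (F (0, z)).1 = 0) ∧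
    (∀ p : ℂ × ℂ, fderiv ℂ F (0, 0) p = (-p.1, (a - 1) * p.2)) ∧
    ((-1 : ℂ) / (a - 1) = 1 / (1 - a)) ∧
    -- (b) nontrivial blow-up equilibria e with e² = 4(1 − 1/a)
    (∀ e : ℂ, e ≠ 0 → (F (0, e) = (0, 0) ↔ e ^ 2 = 4 * (1 - 1 / a))) ∧
    (∀ s : ℂ, s ^ 2 = 1 - 1 / a →
      ∀ e : ℂ, (e ^ 2 = 4 * (1 - 1 / a) ↔ (e = 2 * s ∨ e = -(2 * s)))) ∧
    (∀ e : ℂ, e ≠ 0 → e ^ 2 = 4 * (1 - 1 / a) →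
      (∀ p : ℂ × ℂ, fderiv ℂ F (0, e) p =
        (-a * p.1, -e * p.1 + 2 * (1 - a) * p.2)) ∧
      ((-a) / (2 * (1 - a)) = (1 / 2) * (a / (a - 1))) ∧
      (a = 2 → -a = 2 * (1 - a) ∧
        fderiv ℂ F (0, e) ≠ (-2 : ℂ) • ContinuousLinearMap.id ℂ (ℂ × ℂ))) := by
  have hs : a - 1 ≠ 0 := sub_ne_zero.mpr ha1
  have hs' : 1 - a ≠ 0 := sub_ne_zero.mpr (Ne.symm ha1)
  have hJ : ∀ e : ℂ, e ^ 2 = 4 * (1 - 1 / a) → ∀ p : ℂ × ℂ, fderiv ℂ F (0, e) p =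
        (-a * p.1, -e * p.1 + 2 * (1 - a) * p.2) := by
    intro e he p
    have hae : a * e ^ 2 = 4 * (a - 1) := by
      rw [he]
      field_simp
    rw [galerkin_fderiv a F hF]
    ext
    · simp only []
      linear_combination (-p.1 / 4) * hae
    · simp only []
      linear_combination (-3 * p.2 / 4) * hae
  refine ⟨by simp [hF], by simp [hF], by simp [hF], ?_, ?_, ?_, ?_, ?_⟩
  · intro p
    rw [galerkin_fderiv a F hF]
    ext <;> simp
  · rw [div_eq_div_iff hs hs']
    ring
  · intro e he
    rw [hF]
    simp only [Prod.mk.injEq]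
    constructor
    · rintro ⟨-, h⟩
      have h' := (mul_eq_zero.mp h).resolve_left he
      field_simp
      linear_combination (-4) * h'
    · intro h
      have hae : a * e ^ 2 = 4 * (a - 1) := by
        rw [h]
        field_simp
      exact ⟨by simp, by linear_combination (-e / 4) * hae⟩
  · intro s hs2 e
    rw [← hs2, ← sq_eq_sq_iff_eq_or_eq_neg, mul_pow]
    norm_num
  · intro e he h
    refine ⟨hJ e h, ?_, ?_⟩
    · have h1 : 1 - a = -(a - 1) := by ring
      rw [h1]
      field_simp
    · intro ha2
      refine ⟨by rw [ha2]; norm_num, ?_⟩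
      intro hc
      have h1 := hJ e h (1, 0)
      rw [hc] at h1
      have h2 := congrArg Prod.snd h1
      simp at h2
      exact he h2
end
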